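/- Let Ψ⁽⁺²⁾, Ψ⁽⁻²⁾ be smooth on Ω with 𝕽⁽±²⁾Ψ⁽±²⁾ = 0, write 𝓛 = 𝓛⁽⁺²⁾, and define ψ⁽⁺²ʳ⁾ = w⁻¹LΨ⁽⁺²⁾, ψ⁽⁻²ʳ⁾ = w⁻¹L̲Ψ⁽⁻²⁾, α̃⁽⁺²ʳⁱⁿᵗ⁾ = w L(w⁻¹LΨ⁽⁺²⁾), α̃⁽⁻²ʳⁱⁿᵗ⁾ = w L̲(w⁻¹L̲Ψ⁽⁻²⁾), α̃⁽⁺²ʳ⁾ = (𝓛⁽⁺²⁾(𝓛⁽⁺²⁾−2)+12M∂ₜ)α̃⁽⁺²ʳⁱⁿᵗ⁾ and α̃⁽⁻²ʳ⁾ = (𝓛⁽⁻²⁾(𝓛⁽⁻²⁾−2)−12M∂ₜ)α̃⁽⁻²ʳⁱⁿᵗ⁾. Let 𝒟 be the set of operators P = ∂ₜʲ∘(𝓛)ⁿ with 0≤j≤3, 0≤n≤2. Assume: (H1) for each q in { Ψ⁽⁺²⁾, (Ψ⁽⁻²⁾)*, ψ⁽⁺²ʳ⁾, (ψ⁽⁻²ʳ⁾)*,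 α̃⁽⁺²ʳⁱⁿᵗ⁾, (α̃⁽⁻²ʳⁱⁿᵗ⁾)* } and each P∈𝒟, the functions Pq, PLq and PL̲q converge at infinity to limits that are smooth in (t,ϑ,φ), with the limits commuting with ∂ₜ, ∂_ϑ, ∂_φ; (H2) the Regge–Wheeler boundary conditions hold together with their derivatives: for each P∈𝒟, P( Ψ⁽⁺²⁾ − (Ψ⁽⁻²⁾)* ) → 0 and P( LLΨ⁽⁺²⁾ + L̲L̲(Ψ⁽⁻²⁾)* + (1/(6M))𝓛(𝓛−2)( LΨ⁽⁺²⁾ − L̲(Ψ⁽⁻²⁾)* ) ) → 0 at infinity. Then α̃⁽⁺²ʳ⁾, α̃⁽⁻²ʳ⁾ satisfy the conformal Teukolsky boundary conditions: α̃⁽⁺²ʳ⁾ − (α̃⁽⁻²ʳ⁾)* → 0, L̲α̃⁽⁺²ʳ⁾ − L(α̃⁽⁻²ʳ⁾)* → 0, and r²∂ᵣα̃⁽⁺²ʳ⁾ + r²∂ᵣ(α̃⁽⁻²ʳ⁾)* → 0 at infinity. -/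

import Mathlib

/- Schwarzschild-Anti-de Sitter background: basic operators on functions
   u(t, r, ϑ, φ) with values in ℂ. -/

noncomputable section

open Filter Topology Set

namespace Grav

abbrev F4 : Type := ℝ → ℝ → ℝ → ℝ → ℂ

/-- `Δ(r) = r² + k²r⁴ − 2Mr`. -/
def Del (M k r : ℝ) : ℝ := r ^ 2 + k ^ 2 * r ^ 4 - 2 * M * r

/-- `∂ₜ`. -/
def dT (u : F4) : F4 := fun t r ϑ φ => deriv (fun s => u s r ϑ φ) t
/-- `∂ᵣ`. -/
def dR (u : F4) : F4 := fun t r ϑ φ => deriv (fun s => u t s ϑ φ) r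
/-- `∂_ϑ`. -/
def dTh (u : F4) : F4 := fun t r ϑ φ => deriv (fun s => u t r s φ) ϑ
/-- `∂_φ`. -/
def dPh (u : F4) : F4 := fun t r ϑ φ => deriv (fun s => u t r ϑ s) φ

/-- `L u = ∂ₜ u + (Δ/r²) ∂ᵣ u`. -/
def opL (M k : ℝ) (u : F4) : F4 := fun t r ϑ φ =>
  dT u t r ϑ φ + ((Del M k r / r ^ 2 : ℝ) : ℂ) * dR u t r ϑ φ

/-- `L̲ u = ∂ₜ u − (Δ/r²) ∂ᵣ u`. -/
def opLb (M k : ℝ) (u : F4) : F4 := fun t r ϑ φ =>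
  dT u t r ϑ φ - ((Del M k r / r ^ 2 : ℝ) : ℂ) * dR u t r ϑ φ

/-- `w = Δ/r⁴`. -/
def ww (M k r : ℝ) : ℝ := Del M k r / r ^ 4
/-- `w′ = w·(6M − 2r)/r²`. -/
def wwP (M k r : ℝ) : ℝ := ww M k r * (6 * M - 2 * r) / r ^ 2

/-- The angular operator `𝓛⁽⁺²⁾`. -/
def angP (u : F4) : F4 := fun t r ϑ φ =>
  -(Real.sin ϑ : ℂ)⁻¹ * deriv (fun x => (Real.sin x : ℂ) * dTh u t r x φ) ϑ
  - (((Real.sin ϑ) ^ 2 : ℝ) : ℂ)⁻¹ * dPh (dPh u) t r ϑ φ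
  - 4 * Complex.I * ((Real.cos ϑ / (Real.sin ϑ) ^ 2 : ℝ) : ℂ) * dPh u t r ϑ φ
  + 4 * (((Real.cos ϑ / Real.sin ϑ) ^ 2 : ℝ) : ℂ) * u t r ϑ φ
  + 4 * u t r ϑ φ

/-- The angular operator `𝓛⁽⁻²⁾`. -/
def angM (u : F4) : F4 := fun t r ϑ φ =>
  -(Real.sin ϑ : ℂ)⁻¹ * deriv (fun x => (Real.sin x : ℂ) * dTh u t r x φ) ϑ
  - (((Real.sin ϑ) ^ 2 : ℝ) : ℂ)⁻¹ * dPh (dPh u) t r ϑ φ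
  + 4 * Complex.I * ((Real.cos ϑ / (Real.sin ϑ) ^ 2 : ℝ) : ℂ) * dPh u t r ϑ φ
  + 4 * (((Real.cos ϑ / Real.sin ϑ) ^ 2 : ℝ) : ℂ) * u t r ϑ φ
  + 4 * u t r ϑ φ

/-- The Teukolsky operator `𝔗⁽⁺²⁾u = −LL̲u + 2(w′/w)L̲u − w(𝓛⁽⁺²⁾ − 2 + 6M/r)u`. -/
def Tp (M k : ℝ) (u : F4) : F4 := fun t r ϑ φ =>
  - opL M k (opLb M k u) t r ϑ φ
  + 2 * ((wwP M k r / ww M k r : ℝ) : ℂ) * opLb M k u t r ϑ φ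
  - ((ww M k r : ℝ) : ℂ) *
      (angP u t r ϑ φ - 2 * u t r ϑ φ + ((6 * M / r : ℝ) : ℂ) * u t r ϑ φ)

/-- The Teukolsky operator `𝔗⁽⁻²⁾u = −LL̲u − 2(w′/w)Lu − w(𝓛⁽⁻²⁾ − 2 + 6M/r)u`. -/
def Tm (M k : ℝ) (u : F4) : F4 := fun t r ϑ φ =>
  - opL M k (opLb M k u) t r ϑ φ
  - 2 * ((wwP M k r / ww M k r : ℝ) : ℂ) * opL M k u t r ϑ φ
  - ((ww M k r : ℝ) : ℂ) *
      (angM u t r ϑ φ - 2 * u t r ϑ φ + ((6 * M / r : ℝ) : ℂ) * u t r ϑ φ)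

/-- The Regge–Wheeler operator `𝕽⁽⁺²⁾u = −LL̲u − w(𝓛⁽⁺²⁾ − 6M/r)u`. -/
def RWp (M k : ℝ) (u : F4) : F4 := fun t r ϑ φ =>
  - opL M k (opLb M k u) t r ϑ φ
  - ((ww M k r : ℝ) : ℂ) * (angP u t r ϑ φ - ((6 * M / r : ℝ) : ℂ) * u t r ϑ φ)

/-- The Regge–Wheeler operator `𝕽⁽⁻²⁾u = −LL̲u − w(𝓛⁽⁻²⁾ − 6M/r)u`. -/
def RWm (M k : ℝ) (u : F4) : F4 := fun t r ϑ φ =>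
  - opL M k (opLb M k u) t r ϑ φ
  - ((ww M k r : ℝ) : ℂ) * (angM u t r ϑ φ - ((6 * M / r : ℝ) : ℂ) * u t r ϑ φ)

/-- The exterior region `Ω = {r > r₊, 0 < ϑ < π}` (as a subset of ℝ⁴). -/
def OmSet (rp : ℝ) : Set (ℝ × ℝ × ℝ × ℝ) :=
  {p | rp < p.2.1 ∧ 0 < p.2.2.1 ∧ p.2.2.1 < Real.pi}

/-- `u` is smooth on `Ω`. -/
def SmoothOnOm (rp : ℝ) (u : F4) : Prop :=
  ContDiffOn ℝ (⊤ : ℕ∞)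
    (fun p : ℝ × ℝ × ℝ × ℝ => u p.1 p.2.1 p.2.2.1 p.2.2.2) (OmSet rp)

/-- Multiplication by `w⁻¹`. -/
def winv (M k : ℝ) (u : F4) : F4 := fun t r ϑ φ => ((ww M k r : ℝ) : ℂ)⁻¹ * u t r ϑ φ
/-- Multiplication by `w`. -/
def wmul (M k : ℝ) (u : F4) : F4 := fun t r ϑ φ => ((ww M k r : ℝ) : ℂ) * u t r ϑ φ
/-- Pointwise complex conjugation. -/
def conjF (u : F4) : F4 := fun t r ϑ φ => (starRingEnd ℂ) (u t r ϑ φ)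

/-- `𝓛⁽⁺²⁾(𝓛⁽⁺²⁾ − 2)`. -/
def angSqP (u : F4) : F4 := angP (fun t r ϑ φ => angP u t r ϑ φ - 2 * u t r ϑ φ)
/-- `𝓛⁽⁻²⁾(𝓛⁽⁻²⁾ − 2)`. -/
def angSqM (u : F4) : F4 := angM (fun t r ϑ φ => angM u t r ϑ φ - 2 * u t r ϑ φ)

/-- `𝓛⁽⁺²⁾(𝓛⁽⁺²⁾ − 2) + 12M∂ₜ`. -/
def TSp (M : ℝ) (u : F4) : F4 := fun t r ϑ φ =>
  angSqP u t r ϑ φ + 12 * (M : ℂ) * dT u t r ϑ φ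
/-- `𝓛⁽⁻²⁾(𝓛⁽⁻²⁾ − 2) − 12M∂ₜ`. -/
def TSm (M : ℝ) (u : F4) : F4 := fun t r ϑ φ =>
  angSqM u t r ϑ φ - 12 * (M : ℂ) * dT u t r ϑ φ

/-- `q → 0` at infinity: for every fixed `(t,ϑ,φ)` with `ϑ ∈ (0,π)`,
`q(t,r,ϑ,φ) → 0` as `r → +∞`. -/
def tends0 (q : F4) : Prop :=
  ∀ t φ : ℝ, ∀ ϑ ∈ Set.Ioo (0 : ℝ) Real.pi,
    Tendsto (fun r => q t r ϑ φ) atTop (𝓝 (0 : ℂ))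

/-- `q` converges at infinity to a limit which is smooth in `(t,ϑ,φ)` and which
commutes with `∂ₜ`, `∂_ϑ`, `∂_φ`. -/
def Nice (q : F4) : Prop :=
  ∃ q0 : ℝ → ℝ → ℝ → ℂ,
    ContDiffOn ℝ (⊤ : ℕ∞) (fun p : ℝ × ℝ × ℝ => q0 p.1 p.2.1 p.2.2)
      {p : ℝ × ℝ × ℝ | 0 < p.2.1 ∧ p.2.1 < Real.pi} ∧
    ∀ t φ : ℝ, ∀ ϑ ∈ Set.Ioo (0 : ℝ) Real.pi,
      Tendsto (fun r => q t r ϑ φ) atTop (𝓝 (q0 t ϑ φ)) ∧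
      Tendsto (fun r => dT q t r ϑ φ) atTop (𝓝 (deriv (fun s => q0 s ϑ φ) t)) ∧
      Tendsto (fun r => dTh q t r ϑ φ) atTop (𝓝 (deriv (fun s => q0 t s φ) ϑ)) ∧
      Tendsto (fun r => dPh q t r ϑ φ) atTop (𝓝 (deriv (fun s => q0 t ϑ s) φ))

open MeasureTheory in
/-- If first-order quantities `f r`, `g r`, `e r` tend to zero pointwise and the divergence-type
expression `∂₁ f + ∂₂ g + e` converges pointwise to a continuous function, that function is zero. -/
theorem eq_zero_of_tendsto_divergence {U : Set (ℝ × ℝ)} (hU : IsOpen U) {R : ℝ}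
    {f g e : ℝ → ℝ × ℝ → ℂ} {c : ℝ × ℝ → ℂ}
    (hf : ∀ r, R < r → ContDiffOn ℝ 1 (f r) U) (hg : ∀ r, R < r → ContDiffOn ℝ 1 (g r) U)
    (hc : ContinuousOn c U)
    (hf0 : ∀ y ∈ U, Tendsto (fun r => f r y) atTop (𝓝 0))
    (hg0 : ∀ y ∈ U, Tendsto (fun r => g r y) atTop (𝓝 0))
    (he0 : ∀ y ∈ U, Tendsto (fun r => e r y) atTop (𝓝 0))
    (hlim : ∀ y ∈ U, Tendsto
      (fun r => fderiv ℝ (f r) y (1, 0) + fderiv ℝ (g r) y (0, 1) + e r y) atTop (𝓝 (c y))) :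
    ∀ y ∈ U, c y = 0 := by
  intro y₀ hy₀
  by_contra hne
  set G : ℝ → ℝ × ℝ → ℂ :=
    fun r y => fderiv ℝ (f r) y (1, 0) + fderiv ℝ (g r) y (0, 1) with hG
  have hGc : ∀ r, R < r → ContinuousOn (G r) U := fun r hr =>
    (((hf r hr).continuousOn_fderiv_of_isOpen hU le_rfl).clm_apply continuousOn_const).add
      (((hg r hr).continuousOn_fderiv_of_isOpen hU le_rfl).clm_apply continuousOn_const)
  have hG0 : ∀ y ∈ U, Tendsto (fun r => G r y) atTop (𝓝 (c y)) := fun y hy => by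
    simpa [hG] using (hlim y hy).sub (he0 y hy)
  -- a closed ball on which `c` is close to `c y₀`
  have hnear : ∀ᶠ y in 𝓝 y₀, y ∈ U ∧ ‖c y - c y₀‖ < ‖c y₀‖ / 2 := by
    refine Filter.Eventually.and (hU.mem_nhds hy₀) ?_
    have h1 : ContinuousAt (fun y => ‖c y - c y₀‖) y₀ :=
      ((hc.continuousAt (hU.mem_nhds hy₀)).sub continuousAt_const).norm
    refine h1.eventually_lt continuousAt_const ?_
    simpa using hne
  obtain ⟨ε, hε, hball⟩ := Metric.nhds_basis_closedBall.eventually_iff.1 hnear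
  have hBU : Metric.closedBall y₀ ε ⊆ U := fun y hy => (hball hy).1
  -- uniform bounds on an open subset, by Baire
  set Z : ℕ → Set (ℝ × ℝ) := fun N => Metric.closedBall y₀ ε ∩
    ⋂ r : {r : ℝ // R < r ∧ (N : ℝ) ≤ r}, Metric.closedBall y₀ ε ∩
      {y | (‖f r y‖ ≤ N ∧ ‖g r y‖ ≤ N) ∧ ‖G r y‖ ≤ N} with hZ
  have hZc : ∀ N, IsClosed (Z N) := by
    intro N
    refine Metric.isClosed_closedBall.inter (isClosed_iInter fun r => ?_)
    have h1 : ∀ h : ℝ × ℝ → ℂ, ContinuousOn h U →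
        IsClosed (Metric.closedBall y₀ ε ∩ {y | ‖h y‖ ≤ N}) := fun h hh =>
      (hh.mono hBU).norm.preimage_isClosed_of_isClosed Metric.isClosed_closedBall isClosed_Iic
    have h2 := ((h1 _ (hf r r.2.1).continuousOn).inter (h1 _ (hg r r.2.1).continuousOn)).inter
      (h1 _ (hGc r r.2.1))
    refine Eq.mpr (congrArg IsClosed (Set.ext fun y => ?_)) h2
    exact ⟨fun ⟨h, ⟨k₁, k₂⟩, k₃⟩ => ⟨⟨⟨h, k₁⟩, h, k₂⟩, h, k₃⟩,
      fun ⟨⟨⟨h, k₁⟩, _, k₂⟩, _, k₃⟩ => ⟨h, ⟨k₁, k₂⟩, k₃⟩⟩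
  have hbd : ∀ {h : ℝ → ℂ} {z : ℂ}, Tendsto h atTop (𝓝 z) → 
      ∃ N : ℕ, ∀ r : ℝ, N ≤ r → ‖h r‖ ≤ N := by
    intro h z hz
    obtain ⟨a, ha⟩ := eventually_atTop.1 (hz.norm.eventually (gt_mem_nhds (lt_add_one ‖z‖)))
    obtain ⟨N, hN⟩ := exists_nat_ge (max a (‖z‖ + 1))
    exact ⟨N, fun r hr => (ha r ((le_max_left _ _).trans (hN.trans hr))).le.trans
      ((le_max_right _ _).trans hN)⟩
  have hcover : ⋃ N, ((Metric.ball y₀ ε)ᶜ ∪ Z N) = univ := by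
    refine eq_univ_of_forall fun y => ?_
    by_cases hy : y ∈ Metric.ball y₀ ε
    · have hyB := Metric.ball_subset_closedBall hy
      obtain ⟨N₁, h₁⟩ := hbd (hf0 y (hBU hyB))
      obtain ⟨N₂, h₂⟩ := hbd (hg0 y (hBU hyB))
      obtain ⟨N₃, h₃⟩ := hbd (hG0 y (hBU hyB))
      have e₁ : (N₁ : ℝ) ≤ (N₁ + N₂ + N₃ : ℕ) := by exact_mod_cast (by omega)
      have e₂ : (N₂ : ℝ) ≤ (N₁ + N₂ + N₃ : ℕ) := by exact_mod_cast (by omega)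
      have e₃ : (N₃ : ℝ) ≤ (N₁ + N₂ + N₃ : ℕ) := by exact_mod_cast (by omega)
      refine mem_iUnion.2 ⟨N₁ + N₂ + N₃, Or.inr ⟨hyB, mem_iInter.2 fun r => ⟨hyB, ⟨?_, ?_⟩, ?_⟩⟩⟩
      · exact (h₁ r (e₁.trans r.2.2)).trans e₁
      · exact (h₂ r (e₂.trans r.2.2)).trans e₂
      · exact (h₃ r (e₃.trans r.2.2)).trans e₃
    · exact mem_iUnion.2 ⟨0, Or.inl hy⟩
  have hdense := dense_iUnion_interior_of_closed
    (fun N => (Metric.isOpen_ball (x := y₀) (ε := ε)).isClosed_compl.union (hZc N)) hcover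
  obtain ⟨y₁, hy₁, hy₁'⟩ := hdense.inter_open_nonempty _ Metric.isOpen_ball
    ⟨y₀, Metric.mem_ball_self hε⟩
  obtain ⟨N, hN⟩ := mem_iUnion.1 hy₁'
  have hnhds : ∀ᶠ y in 𝓝 y₁, y ∈ Z N := by
    filter_upwards [Metric.isOpen_ball.mem_nhds hy₁, isOpen_interior.mem_nhds hN] with y h1 h2
    rcases interior_subset h2 with h3 | h3
    · exact absurd h1 h3
    · exact h3
  obtain ⟨δ, hδ, hδZ⟩ := Metric.nhds_basis_closedBall.eventually_iff.1 hnhds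
  -- integrate over a rectangle
  set a : ℝ × ℝ := (y₁.1 - δ, y₁.2 - δ) with ha
  set b : ℝ × ℝ := (y₁.1 + δ, y₁.2 + δ) with hb
  have hrect : Icc a b ⊆ Z N := by
    intro y hy
    refine hδZ ?_
    rw [← Prod.mk.eta (p := y₁), ← closedBall_prod_same, Real.closedBall_eq_Icc,
      Real.closedBall_eq_Icc, Icc_prod_Icc]
    exact hy
  have hrU : Icc a b ⊆ U := fun y hy => hBU (hrect hy).1
  have hbound : ∀ y ∈ Icc a b, ∀ r, max (R + 1) N ≤ r →
      (‖f r y‖ ≤ N ∧ ‖g r y‖ ≤ N) ∧ ‖G r y‖ ≤ N := fun y hy r hr =>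
    (mem_iInter.1 (hrect hy).2
      ⟨r, (lt_add_one R).trans_le ((le_max_left _ _).trans hr), (le_max_right _ _).trans hr⟩).2
  have hRr : ∀ {r}, max (R + 1) N ≤ r → R < r := fun hr =>
    (lt_add_one R).trans_le ((le_max_left _ _).trans hr)
  have hle1 : a.1 ≤ b.1 := by simp only [ha, hb]; linarith
  have hle2 : a.2 ≤ b.2 := by simp only [ha, hb]; linarith
  have hlim1 : Tendsto (fun r => ∫ y in Icc a b, G r y) atTop (𝓝 (∫ y in Icc a b, c y)) := by
    refine tendsto_integral_filter_of_dominated_convergence (fun _ => (N : ℝ)) ?_ ?_ ?_ ?_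
    · filter_upwards [eventually_ge_atTop (max (R + 1) (N : ℝ))] with r hr
      exact ((hGc r (hRr hr)).mono hrU).aestronglyMeasurable measurableSet_Icc
    · filter_upwards [eventually_ge_atTop (max (R + 1) (N : ℝ))] with r hr
      exact (ae_restrict_iff' measurableSet_Icc).2 (.of_forall fun y hy => (hbound y hy r hr).2)
    · exact integrableOn_const (isCompact_Icc.measure_lt_top.ne)
    · exact (ae_restrict_iff' measurableSet_Icc).2 (.of_forall fun y hy => hG0 y (hrU hy))
  have hside : ∀ (h : ℝ → ℝ × ℝ → ℂ) (γ : ℝ → ℝ × ℝ) (x₀ x₁ : ℝ), Continuous γ → x₀ ≤ x₁ →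
      (∀ x ∈ Icc x₀ x₁, γ x ∈ Icc a b) → (∀ r, R < r → ContinuousOn (h r) U) →
      (∀ y ∈ Icc a b, ∀ r, max (R + 1) N ≤ r → ‖h r y‖ ≤ N) →
      (∀ y ∈ U, Tendsto (fun r => h r y) atTop (𝓝 0)) →
      Tendsto (fun r => ∫ x in x₀..x₁, h r (γ x)) atTop (𝓝 0) := by
    intro h γ x₀ x₁ hγ hx hγI hh hhb hh0
    have hsub : uIoc x₀ x₁ ⊆ Icc x₀ x₁ := by rw [uIoc_of_le hx]; exact Ioc_subset_Icc_self
    have key : Tendsto (fun r => ∫ x in x₀..x₁, h r (γ x)) atTop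
        (𝓝 (∫ _ in x₀..x₁, (0 : ℂ))) := by
      refine intervalIntegral.tendsto_integral_filter_of_dominated_convergence
        (fun _ => (N : ℝ)) ?_ ?_ ?_ ?_
      · filter_upwards [eventually_ge_atTop (max (R + 1) (N : ℝ))] with r hr
        refine ContinuousOn.aestronglyMeasurable ?_ measurableSet_uIoc
        exact (hh r (hRr hr)).comp hγ.continuousOn fun x hx => hrU (hγI x (hsub hx))
      · filter_upwards [eventually_ge_atTop (max (R + 1) (N : ℝ))] with r hr
        exact .of_forall fun x hx => hhb _ (hγI x (hsub hx)) r hr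
      · exact intervalIntegrable_const
      · exact .of_forall fun x hx => hh0 _ (hrU (hγI x (hsub hx)))
    simpa using key
  have hlim0 : Tendsto (fun r => ∫ y in Icc a b, G r y) atTop (𝓝 0) := by
    have s1 := hside g (fun x => (x, b.2)) a.1 b.1 (by fun_prop) hle1
      (fun x hx => ⟨⟨hx.1, hle2⟩, ⟨hx.2, le_rfl⟩⟩) (fun r hr => (hg r hr).continuousOn)
      (fun y hy r hr => (hbound y hy r hr).1.2) hg0
    have s2 := hside g (fun x => (x, a.2)) a.1 b.1 (by fun_prop) hle1
      (fun x hx => ⟨⟨hx.1, le_rfl⟩, ⟨hx.2, hle2⟩⟩) (fun r hr => (hg r hr).continuousOn)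
      (fun y hy r hr => (hbound y hy r hr).1.2) hg0
    have s3 := hside f (fun x => (b.1, x)) a.2 b.2 (by fun_prop) hle2
      (fun x hx => ⟨⟨hle1, hx.1⟩, ⟨le_rfl, hx.2⟩⟩) (fun r hr => (hf r hr).continuousOn)
      (fun y hy r hr => (hbound y hy r hr).1.1) hf0
    have s4 := hside f (fun x => (a.1, x)) a.2 b.2 (by fun_prop) hle2
      (fun x hx => ⟨⟨le_rfl, hx.1⟩, ⟨hle1, hx.2⟩⟩) (fun r hr => (hf r hr).continuousOn)
      (fun y hy r hr => (hbound y hy r hr).1.1) hf0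
    have s := ((s1.sub s2).add s3).sub s4
    simp only [sub_zero, add_zero] at s
    refine s.congr' ?_
    filter_upwards [eventually_ge_atTop (max (R + 1) (N : ℝ))] with r hr
    have hio : Ioo a.1 b.1 ×ˢ Ioo a.2 b.2 ⊆ U := fun y hy =>
      hrU ⟨⟨hy.1.1.le, hy.2.1.le⟩, ⟨hy.1.2.le, hy.2.2.le⟩⟩
    have hr' := hRr hr
    refine (integral_divergence_prod_Icc_of_hasFDerivAt_of_le (f r) (g r) (fderiv ℝ (f r))
      (fderiv ℝ (g r)) a b ⟨hle1, hle2⟩ ((hf r hr').continuousOn.mono hrU)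
      ((hg r hr').continuousOn.mono hrU) (fun y hy => ?_) (fun y hy => ?_) ?_).symm
    · exact (((hf r hr').differentiableOn one_ne_zero).differentiableAt
        (hU.mem_nhds (hio hy))).hasFDerivAt
    · exact (((hg r hr').differentiableOn one_ne_zero).differentiableAt
        (hU.mem_nhds (hio hy))).hasFDerivAt
    · exact ((hGc r hr').mono hrU).integrableOn_compact isCompact_Icc
  have hint0 : ∫ y in Icc a b, c y = 0 := tendsto_nhds_unique hlim1 hlim0
  have hvol : 0 < volume.real (Icc a b) := by
    rw [← Icc_prod_Icc, Measure.volume_eq_prod, measureReal_prod_prod, Real.volume_real_Icc,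
      Real.volume_real_Icc]
    have h1 : 0 < y₁.1 + δ - (y₁.1 - δ) := by linarith
    have h2 : 0 < y₁.2 + δ - (y₁.2 - δ) := by linarith
    exact mul_pos (lt_max_of_lt_left h1) (lt_max_of_lt_left h2)
  have hnorm := norm_setIntegral_le_of_norm_le_const (μ := volume) (f := fun y => c y - c y₀)
    (C := ‖c y₀‖ / 2) (isCompact_Icc.measure_lt_top (K := Icc a b))
    (fun y hy => (hball (hrect hy).1).2.le)
  rw [integral_sub ((hc.mono hrU).integrableOn_compact isCompact_Icc)
    (integrableOn_const (isCompact_Icc.measure_lt_top.ne)), hint0, zero_sub, norm_neg,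
    setIntegral_const, norm_smul, Real.norm_of_nonneg hvol.le] at hnorm
  have hpos : 0 < ‖c y₀‖ := norm_pos_iff.2 hne
  nlinarith [mul_pos hvol hpos]

section

variable {rp : ℝ}

theorem isOpen_OmSet (rp : ℝ) : IsOpen (OmSet rp) :=
  (isOpen_lt continuous_const (continuous_fst.comp continuous_snd)).inter
    ((isOpen_lt continuous_const (continuous_fst.comp (continuous_snd.comp continuous_snd))).inter
      (isOpen_lt (continuous_fst.comp (continuous_snd.comp continuous_snd)) continuous_const))

/-- Smooth functions on `Ω`, extended by zero. -/
def Sm (rp : ℝ) : Submodule ℂ (ℝ × ℝ × ℝ × ℝ → ℂ) where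
  carrier := {u | ContDiffOn ℝ (⊤ : ℕ∞) u (OmSet rp) ∧ ∀ p ∉ OmSet rp, u p = 0}
  add_mem' := fun ha hb => ⟨ha.1.add hb.1, fun p hp => by simp [ha.2 p hp, hb.2 p hp]⟩
  zero_mem' := ⟨contDiffOn_const, fun _ _ => rfl⟩
  smul_mem' := fun c _ ha => ⟨contDiffOn_const.mul ha.1, fun p hp => by simp [ha.2 p hp]⟩


theorem Sm.ext_on {u v : Sm rp} (h : ∀ p ∈ OmSet rp, u.1 p = v.1 p) : u = v := by
  refine Subtype.ext (funext fun p => ?_)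
  by_cases hp : p ∈ OmSet rp
  · exact h p hp
  · rw [u.2.2 p hp, v.2.2 p hp]

theorem Sm.contDiffAt (u : Sm rp) {p : ℝ × ℝ × ℝ × ℝ} (hp : p ∈ OmSet rp) :
    ContDiffAt ℝ (⊤ : ℕ∞) u.1 p :=
  u.2.1.contDiffAt ((isOpen_OmSet rp).mem_nhds hp)

theorem Sm.differentiableAt (u : Sm rp) {p : ℝ × ℝ × ℝ × ℝ} (hp : p ∈ OmSet rp) :
    DifferentiableAt ℝ u.1 p :=
  (Sm.contDiffAt u hp).differentiableAt (by simp)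

open Classical in
/-- Restriction to `Ω` of a function that is smooth there. -/
def cut (u : ℝ × ℝ × ℝ × ℝ → ℂ) (hu : ContDiffOn ℝ (⊤ : ℕ∞) u (OmSet rp)) : Sm rp :=
  ⟨fun p => if p ∈ OmSet rp then u p else 0,
    hu.congr fun _ hp => if_pos hp, fun _ hp => if_neg hp⟩

theorem cut_apply {u : ℝ × ℝ × ℝ × ℝ → ℂ} (hu : ContDiffOn ℝ (⊤ : ℕ∞) u (OmSet rp))
    {p : ℝ × ℝ × ℝ × ℝ} (hp : p ∈ OmSet rp) : (cut u hu).1 p = u p := if_pos hp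

theorem cut_eventuallyEq {u : ℝ × ℝ × ℝ × ℝ → ℂ} (hu : ContDiffOn ℝ (⊤ : ℕ∞) u (OmSet rp))
    {p : ℝ × ℝ × ℝ × ℝ} (hp : p ∈ OmSet rp) : (cut u hu).1 =ᶠ[𝓝 p] u := by
  filter_upwards [(isOpen_OmSet rp).mem_nhds hp] with q hq using cut_apply hu hq

theorem Sm.contDiffOn_fderiv (u : Sm rp) :
    ContDiffOn ℝ (⊤ : ℕ∞) (fderiv ℝ u.1) (OmSet rp) :=
  u.2.1.fderiv_of_isOpen (isOpen_OmSet rp) (by simp)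

/-- The directional derivative along a constant vector. -/
def D (v : ℝ × ℝ × ℝ × ℝ) : Module.End ℂ (Sm rp) where
  toFun u := cut (fun p => fderiv ℝ u.1 p v) ((Sm.contDiffOn_fderiv u).clm_apply contDiffOn_const)
  map_add' u w := Sm.ext_on fun p hp => by
    simp [cut_apply, hp, fderiv_add (Sm.differentiableAt u hp) (Sm.differentiableAt w hp)]
  map_smul' c u := Sm.ext_on fun p hp => by
    simp [cut_apply, hp, fderiv_const_smul (Sm.differentiableAt u hp)]

theorem D_apply (v : ℝ × ℝ × ℝ × ℝ) (u : Sm rp) {p : ℝ × ℝ × ℝ × ℝ} (hp : p ∈ OmSet rp) :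
    (D v u).1 p = fderiv ℝ u.1 p v :=
  cut_apply ((Sm.contDiffOn_fderiv u).clm_apply contDiffOn_const) hp

theorem D_comm (v w : ℝ × ℝ × ℝ × ℝ) (u : Sm rp) : D v (D w u) = D w (D v u) := by
  refine Sm.ext_on fun p hp => ?_
  have hd : DifferentiableAt ℝ (fderiv ℝ u.1) p :=
    ((Sm.contDiffOn_fderiv u).contDiffAt ((isOpen_OmSet rp).mem_nhds hp)).differentiableAt (by simp)
  have key : ∀ v w : ℝ × ℝ × ℝ × ℝ, (D v (D w u)).1 p = fderiv ℝ (fderiv ℝ u.1) p v w := by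
    intro v w
    rw [D_apply v _ hp, show (D w u).1 = (cut (fun p => fderiv ℝ u.1 p w)
      ((Sm.contDiffOn_fderiv u).clm_apply contDiffOn_const)).1 from rfl,
      (cut_eventuallyEq _ hp).fderiv_eq, fderiv_clm_apply hd (differentiableAt_const w)]
    simp
  rw [key, key]
  exact (Sm.contDiffAt u hp).isSymmSndFDerivAt (by
    simpa [minSmoothness_of_isRCLikeNormedField] using WithTop.coe_le_coe.2 (le_top (a := (2 : ℕ∞)))) v w

/-- Multiplication by a smooth function. -/
def mulS (c : Sm rp) : Module.End ℂ (Sm rp) where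
  toFun u := ⟨fun p => c.1 p * u.1 p, c.2.1.mul u.2.1, fun p hp => by simp [u.2.2 p hp]⟩
  map_add' u w := Subtype.ext (funext fun p => by simp [mul_add])
  map_smul' a u := Subtype.ext (funext fun p => by simp [mul_left_comm])

theorem mulS_apply (c u : Sm rp) (p : ℝ × ℝ × ℝ × ℝ) : (mulS c u).1 p = c.1 p * u.1 p := rfl

theorem mulS_comm (c d u : Sm rp) : mulS c (mulS d u) = mulS d (mulS c u) :=
  Subtype.ext (funext fun p => by simp [mulS_apply, mul_left_comm])

theorem D_mulS (v : ℝ × ℝ × ℝ × ℝ) (c u : Sm rp) :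
    D v (mulS c u) = mulS c (D v u) + mulS (D v c) u := by
  refine Sm.ext_on fun p hp => ?_
  have h : fderiv ℝ (mulS c u).1 p = c.1 p • fderiv ℝ u.1 p + u.1 p • fderiv ℝ c.1 p :=
    fderiv_mul (Sm.differentiableAt c hp) (Sm.differentiableAt u hp)
  rw [D_apply v _ hp, h]
  simp [mulS_apply, D_apply, hp, mul_comm]

theorem D_mulS_of_eq_zero {v : ℝ × ℝ × ℝ × ℝ} {c : Sm rp} (h : D v c = 0) (u : Sm rp) :
    D v (mulS c u) = mulS c (D v u) := by
  rw [D_mulS, h, show mulS (0 : Sm rp) u = 0 from Subtype.ext (funext fun p => by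
    simp [mulS_apply]), add_zero]

/-- A coefficient depending only on `r`. -/
def coefR (f : ℝ → ℂ) (hf : ContDiffOn ℝ (⊤ : ℕ∞) f (Ioi rp)) : Sm rp :=
  cut (fun p => f p.2.1) (hf.comp (by fun_prop) fun _ hp => hp.1)

/-- A coefficient depending only on `ϑ`. -/
def coefTh (f : ℝ → ℂ) (hf : ContDiffOn ℝ (⊤ : ℕ∞) f (Ioo 0 Real.pi)) : Sm rp :=
  cut (fun p => f p.2.2.1) (hf.comp (by fun_prop) fun _ hp => hp.2)

theorem coefR_apply {f : ℝ → ℂ} (hf : ContDiffOn ℝ (⊤ : ℕ∞) f (Ioi rp))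
    {p : ℝ × ℝ × ℝ × ℝ} (hp : p ∈ OmSet rp) : (coefR f hf).1 p = f p.2.1 := cut_apply _ hp

theorem coefTh_apply {f : ℝ → ℂ} (hf : ContDiffOn ℝ (⊤ : ℕ∞) f (Ioo 0 Real.pi))
    {p : ℝ × ℝ × ℝ × ℝ} (hp : p ∈ OmSet rp) : (coefTh f hf : Sm rp).1 p = f p.2.2.1 :=
  cut_apply _ hp

theorem D_coefR_apply {f : ℝ → ℂ} (hf : ContDiffOn ℝ (⊤ : ℕ∞) f (Ioi rp))
    (v : ℝ × ℝ × ℝ × ℝ) {p : ℝ × ℝ × ℝ × ℝ} (hp : p ∈ OmSet rp) :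
    (D v (coefR f hf)).1 p = v.2.1 • deriv f p.2.1 := by
  rw [D_apply v _ hp, coefR, (cut_eventuallyEq _ hp).fderiv_eq]
  have h1 : HasDerivAt f (deriv f p.2.1) p.2.1 :=
    ((hf.contDiffAt (isOpen_Ioi.mem_nhds hp.1)).differentiableAt (by simp)).hasDerivAt
  have hpr := ((ContinuousLinearMap.fst ℝ ℝ (ℝ × ℝ)).comp
    (ContinuousLinearMap.snd ℝ ℝ (ℝ × ℝ × ℝ))).hasFDerivAt (x := p)
  refine (congrArg (fun l => l v) (h1.hasFDerivAt.comp p hpr).fderiv).trans ?_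
  simp

theorem D_coefTh_apply {f : ℝ → ℂ} (hf : ContDiffOn ℝ (⊤ : ℕ∞) f (Ioo 0 Real.pi))
    (v : ℝ × ℝ × ℝ × ℝ) {p : ℝ × ℝ × ℝ × ℝ} (hp : p ∈ OmSet rp) :
    (D v (coefTh f hf : Sm rp)).1 p = v.2.2.1 • deriv f p.2.2.1 := by
  rw [D_apply v _ hp, coefTh, (cut_eventuallyEq _ hp).fderiv_eq]
  have h1 : HasDerivAt f (deriv f p.2.2.1) p.2.2.1 :=
    ((hf.contDiffAt (isOpen_Ioo.mem_nhds hp.2)).differentiableAt (by simp)).hasDerivAt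
  have hpr := ((ContinuousLinearMap.fst ℝ ℝ ℝ).comp ((ContinuousLinearMap.snd ℝ ℝ (ℝ × ℝ)).comp
    (ContinuousLinearMap.snd ℝ ℝ (ℝ × ℝ × ℝ)))).hasFDerivAt (x := p)
  refine (congrArg (fun l => l v) (h1.hasFDerivAt.comp p hpr).fderiv).trans ?_
  simp

theorem D_coefR_eq_zero {f : ℝ → ℂ} (hf : ContDiffOn ℝ (⊤ : ℕ∞) f (Ioi rp))
    {v : ℝ × ℝ × ℝ × ℝ} (hv : v.2.1 = 0) : D v (coefR f hf) = 0 :=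
  Sm.ext_on fun p hp => by simp [D_coefR_apply hf v hp, hv]

theorem D_coefTh_eq_zero {f : ℝ → ℂ} (hf : ContDiffOn ℝ (⊤ : ℕ∞) f (Ioo 0 Real.pi))
    {v : ℝ × ℝ × ℝ × ℝ} (hv : v.2.2.1 = 0) : D v (coefTh f hf : Sm rp) = 0 :=
  Sm.ext_on fun p hp => by simp [D_coefTh_apply hf v hp, hv]

/-- Coordinate vector of `t`. -/
def eT : ℝ × ℝ × ℝ × ℝ := (1, 0, 0, 0)
/-- Coordinate vector of `r`. -/
def eR : ℝ × ℝ × ℝ × ℝ := (0, 1, 0, 0)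
/-- Coordinate vector of `ϑ`. -/
def eTh : ℝ × ℝ × ℝ × ℝ := (0, 0, 1, 0)
/-- Coordinate vector of `φ`. -/
def ePh : ℝ × ℝ × ℝ × ℝ := (0, 0, 0, 1)

theorem sin_ne_zero_of_mem {x : ℝ} (hx : x ∈ Ioo 0 Real.pi) : Real.sin x ≠ 0 :=
  (Real.sin_pos_of_mem_Ioo hx).ne'

theorem contDiffOn_ofReal {f : ℝ → ℝ} {s : Set ℝ} (hf : ContDiffOn ℝ (⊤ : ℕ∞) f s) :
    ContDiffOn ℝ (⊤ : ℕ∞) (fun x => (f x : ℂ)) s :=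
  Complex.ofRealCLM.contDiff.comp_contDiffOn hf

/-- The coefficient `sin ϑ`. -/
def cSin : Sm rp := coefTh (fun x => (Real.sin x : ℂ))
  (contDiffOn_ofReal Real.contDiff_sin.contDiffOn)
/-- The coefficient `1 / sin ϑ`. -/
def cSinInv : Sm rp := coefTh (fun x => (((Real.sin x)⁻¹ : ℝ) : ℂ))
  (contDiffOn_ofReal (Real.contDiff_sin.contDiffOn.inv fun _ hx => sin_ne_zero_of_mem hx))
/-- The coefficient `1 / sin² ϑ`. -/
def cSinSqInv : Sm rp := coefTh (fun x => (((Real.sin x ^ 2)⁻¹ : ℝ) : ℂ))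
  (contDiffOn_ofReal ((Real.contDiff_sin.contDiffOn.pow 2).inv fun _ hx =>
    pow_ne_zero 2 (sin_ne_zero_of_mem hx)))
/-- The coefficient `4 i cos ϑ / sin² ϑ`. -/
def cPh : Sm rp := coefTh (fun x => 4 * Complex.I * ((Real.cos x / Real.sin x ^ 2 : ℝ) : ℂ))
  (contDiffOn_const.mul (contDiffOn_ofReal (Real.contDiff_cos.contDiffOn.div
    (Real.contDiff_sin.contDiffOn.pow 2) fun _ hx => pow_ne_zero 2 (sin_ne_zero_of_mem hx))))
/-- The coefficient `4 cot² ϑ + 4`. -/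
def cPot : Sm rp := coefTh (fun x => 4 * (((Real.cos x / Real.sin x) ^ 2 : ℝ) : ℂ) + 4)
  ((contDiffOn_const.mul (contDiffOn_ofReal ((Real.contDiff_cos.contDiffOn.div
    Real.contDiff_sin.contDiffOn fun _ hx => sin_ne_zero_of_mem hx).pow 2))).add contDiffOn_const)

/-- The angular operator `𝓛⁽⁺²⁾` on smooth functions. -/
def ang : Module.End ℂ (Sm rp) :=
  -(mulS cSinInv * D eTh * mulS cSin * D eTh) - mulS cSinSqInv * D ePh * D ePh
    - mulS cPh * D ePh + mulS cPot

theorem ang_apply (u : Sm rp) : ang u =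
    -(mulS cSinInv (D eTh (mulS cSin (D eTh u)))) - mulS cSinSqInv (D ePh (D ePh u))
      - mulS cPh (D ePh u) + mulS cPot u := rfl

theorem D_ang {v : ℝ × ℝ × ℝ × ℝ} (hv : v.2.2.1 = 0) (u : Sm rp) :
    D v (ang u) = ang (D v u) := by
  have h : ∀ {f} (hf : ContDiffOn ℝ (⊤ : ℕ∞) f (Ioo 0 Real.pi)) (u : Sm rp),
      D v (mulS (coefTh f hf) u) = mulS (coefTh f hf) (D v u) := fun hf u =>
    D_mulS_of_eq_zero (D_coefTh_eq_zero hf hv) u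
  simp only [ang_apply, map_add, map_sub, map_neg, cSinInv, cSin, cSinSqInv, cPh, cPot, h,
    D_comm v]

theorem ang_mulS {c : Sm rp} (h₁ : D eTh c = 0) (h₂ : D ePh c = 0) (u : Sm rp) :
    ang (mulS c u) = mulS c (ang u) := by
  simp only [ang_apply, map_add, map_sub, map_neg, D_mulS_of_eq_zero h₁, D_mulS_of_eq_zero h₂,
    mulS_comm _ c]

theorem ang_coefR {f : ℝ → ℂ} (hf : ContDiffOn ℝ (⊤ : ℕ∞) f (Ioi rp)) (u : Sm rp) :
    ang (mulS (coefR f hf) u) = mulS (coefR f hf) (ang u) :=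
  ang_mulS (D_coefR_eq_zero hf rfl) (D_coefR_eq_zero hf rfl) u

/-- `u` coincides on `Ω` with the smooth function `σ`. -/
def Rep (u : F4) (σ : Sm rp) : Prop :=
  ∀ t r ϑ φ : ℝ, (t, r, ϑ, φ) ∈ OmSet rp → u t r ϑ φ = σ.1 (t, r, ϑ, φ)

theorem deriv_comp_Sm {g : ℝ → ℂ} {σ : Sm rp} {γ : ℝ → ℝ × ℝ × ℝ × ℝ} {v : ℝ × ℝ × ℝ × ℝ} {x : ℝ}
    (hγ : HasDerivAt γ v x) (hx : γ x ∈ OmSet rp)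
    (hg : ∀ s, γ s ∈ OmSet rp → g s = σ.1 (γ s)) : deriv g x = (D v σ).1 (γ x) := by
  have h1 : g =ᶠ[𝓝 x] fun s => σ.1 (γ s) := by
    filter_upwards [hγ.continuousAt.preimage_mem_nhds ((isOpen_OmSet rp).mem_nhds hx)] with s hs
      using hg s hs
  rw [h1.deriv_eq, D_apply v _ hx]
  exact ((Sm.differentiableAt σ hx).hasFDerivAt.comp_hasDerivAt x hγ).deriv

namespace Rep

variable {u v : F4} {σ τ : Sm rp}

theorem dT (h : Rep u σ) : Rep (dT u) (D eT σ) := fun t r ϑ φ hp =>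
  deriv_comp_Sm (γ := fun s => (s, r, ϑ, φ))
    ((hasDerivAt_id t).prodMk (hasDerivAt_const t (r, ϑ, φ))) hp fun s hs => h s r ϑ φ hs

theorem dR (h : Rep u σ) : Rep (dR u) (D eR σ) := fun t r ϑ φ hp =>
  deriv_comp_Sm (γ := fun s => (t, s, ϑ, φ))
    ((hasDerivAt_const r t).prodMk ((hasDerivAt_id r).prodMk (hasDerivAt_const r (ϑ, φ))))
    hp fun s hs => h t s ϑ φ hs

theorem dTh (h : Rep u σ) : Rep (dTh u) (D eTh σ) := fun t r ϑ φ hp =>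
  deriv_comp_Sm (γ := fun s => (t, r, s, φ))
    ((hasDerivAt_const ϑ t).prodMk ((hasDerivAt_const ϑ r).prodMk
      ((hasDerivAt_id ϑ).prodMk (hasDerivAt_const ϑ φ))))
    hp fun s hs => h t r s φ hs

theorem dPh (h : Rep u σ) : Rep (dPh u) (D ePh σ) := fun t r ϑ φ hp =>
  deriv_comp_Sm (γ := fun s => (t, r, ϑ, s))
    ((hasDerivAt_const φ t).prodMk ((hasDerivAt_const φ r).prodMk
      ((hasDerivAt_const φ ϑ).prodMk (hasDerivAt_id φ))))
    hp fun s hs => h t r ϑ s hs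

theorem add (hu : Rep u σ) (hv : Rep v τ) :
    Rep (fun t r ϑ φ => u t r ϑ φ + v t r ϑ φ) (σ + τ) := fun t r ϑ φ hp => by
  simp [hu t r ϑ φ hp, hv t r ϑ φ hp]

theorem sub (hu : Rep u σ) (hv : Rep v τ) :
    Rep (fun t r ϑ φ => u t r ϑ φ - v t r ϑ φ) (σ - τ) := fun t r ϑ φ hp => by
  simp [hu t r ϑ φ hp, hv t r ϑ φ hp]

theorem const_mul (a : ℂ) (hu : Rep u σ) :
    Rep (fun t r ϑ φ => a * u t r ϑ φ) (a • σ) := fun t r ϑ φ hp => by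
  simp [hu t r ϑ φ hp]

theorem coefR_mul {f : ℝ → ℂ} (hf : ContDiffOn ℝ (⊤ : ℕ∞) f (Ioi rp)) (hu : Rep u σ) :
    Rep (fun t r ϑ φ => f r * u t r ϑ φ) (mulS (coefR f hf) σ) := fun t r ϑ φ hp => by
  simp [hu t r ϑ φ hp, mulS_apply, coefR_apply, hp]

theorem coefTh_mul {f : ℝ → ℂ} (hf : ContDiffOn ℝ (⊤ : ℕ∞) f (Ioo 0 Real.pi)) (hu : Rep u σ) :
    Rep (fun t r ϑ φ => f ϑ * u t r ϑ φ) (mulS (coefTh f hf) σ) := fun t r ϑ φ hp => by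
  simp [hu t r ϑ φ hp, mulS_apply, coefTh_apply, hp]

theorem angP (h : Rep u σ) : Rep (angP u) (ang σ) := by
  intro t r ϑ φ hp
  have h1 := (coefTh_mul (contDiffOn_ofReal Real.contDiff_sin.contDiffOn) h.dTh).dTh t r ϑ φ hp
  have h2 := h.dPh.dPh t r ϑ φ hp
  have h3 := h.dPh t r ϑ φ hp
  have h4 := h t r ϑ φ hp
  simp only [Grav.dTh] at h1
  simp only [Grav.angP, Grav.dTh, h2, h3, h4, h1]
  simp [ang_apply, mulS_apply, cSinInv, cSin, cSinSqInv, cPh, cPot, coefTh_apply, hp]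
  ring

theorem dT_iterate (h : Rep u σ) (j : ℕ) : Rep (Grav.dT^[j] u) ((D eT)^[j] σ) := by
  induction j with
  | zero => exact h
  | succ j ih => rw [Function.iterate_succ_apply', Function.iterate_succ_apply']; exact ih.dT

theorem angP_iterate (h : Rep u σ) (n : ℕ) : Rep (Grav.angP^[n] u) (ang^[n] σ) := by
  induction n with
  | zero => exact h
  | succ j ih => rw [Function.iterate_succ_apply', Function.iterate_succ_apply']; exact ih.angP

theorem angSqP (h : Rep u σ) : Rep (angSqP u) (ang (ang σ - (2 : ℂ) • σ)) :=
  (h.angP.sub (h.const_mul 2)).angP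

end Rep

theorem rep_of_smooth {u : F4} (h : SmoothOnOm rp u) : Rep u (cut _ h) :=
  fun _ _ _ _ hp => (cut_apply h hp).symm

/-- Admissible mass, cosmological constant and horizon radius. -/
structure Background (M k rp : ℝ) : Prop where
  M_pos : 0 < M
  k_pos : 0 < k
  rp_pos : 0 < rp
  root : rp + k ^ 2 * rp ^ 3 - 2 * M = 0

namespace Background

variable {M k : ℝ}

theorem ww_pos (h : Background M k rp) {r : ℝ} (hr : rp < r) : 0 < ww M k r := by
  have h0 := h.rp_pos
  have hr0 : 0 < r := h0.trans hr
  have h3 : rp ^ 3 < r ^ 3 := pow_lt_pow_left₀ hr h0.le (by norm_num)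
  have hk2 : 0 < k ^ 2 := pow_pos h.k_pos 2
  have : 0 < r + k ^ 2 * r ^ 3 - 2 * M := by nlinarith [h.root]
  refine div_pos ?_ (by positivity)
  rw [show Del M k r = r * (r + k ^ 2 * r ^ 3 - 2 * M) by unfold Del; ring]
  positivity

theorem hasDerivAt_ww {r : ℝ} (hr : r ≠ 0) :
    HasDerivAt (ww M k) (-2 * r⁻¹ ^ 3 + 6 * M * r⁻¹ ^ 4) r := by
  have h1 := ((((hasDerivAt_id r).pow 2).add (((hasDerivAt_id r).pow 4).const_mul (k ^ 2))).sub
    ((hasDerivAt_id r).const_mul (2 * M))).div ((hasDerivAt_id r).pow 4) (pow_ne_zero 4 hr)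
  refine h1.congr_deriv ?_
  simp
  field_simp
  ring

theorem contDiffOn_ww (h : Background M k rp) :
    ContDiffOn ℝ (⊤ : ℕ∞) (ww M k) (Ioi rp) := by
  unfold ww Del
  exact ContDiffOn.div (by fun_prop) (by fun_prop) fun r hr =>
    pow_ne_zero 4 (h.rp_pos.trans hr).ne'

/-- Multiplication by `1 / r`. -/
def opV (h : Background M k rp) : Module.End ℂ (Sm rp) :=
  mulS (coefR (fun r => ((r⁻¹ : ℝ) : ℂ))
    (contDiffOn_ofReal (contDiffOn_id.inv fun _ hr => (h.rp_pos.trans hr).ne')))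

/-- Multiplication by `w`. -/
def opW (h : Background M k rp) : Module.End ℂ (Sm rp) :=
  mulS (coefR (fun r => ((ww M k r : ℝ) : ℂ)) (contDiffOn_ofReal h.contDiffOn_ww))

theorem contDiffOn_ww_inv (h : Background M k rp) :
    ContDiffOn ℝ (⊤ : ℕ∞) (fun r => ((ww M k r : ℝ) : ℂ)⁻¹) (Ioi rp) := by
  simpa using contDiffOn_ofReal (h.contDiffOn_ww.inv fun r hr => (h.ww_pos hr).ne')

/-- Multiplication by `1 / w`. -/
def opWi (h : Background M k rp) : Module.End ℂ (Sm rp) :=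
  mulS (coefR _ h.contDiffOn_ww_inv)

theorem contDiffOn_speed (h : Background M k rp) :
    ContDiffOn ℝ (⊤ : ℕ∞) (fun r => ((Del M k r / r ^ 2 : ℝ) : ℂ)) (Ioi rp) := by
  refine contDiffOn_ofReal ?_
  unfold Del
  exact ContDiffOn.div (by fun_prop) (by fun_prop) fun r hr =>
    pow_ne_zero 2 (h.rp_pos.trans hr).ne'

/-- The radial derivation `(Δ/r²) ∂ᵣ`. -/
def opX (h : Background M k rp) : Module.End ℂ (Sm rp) :=
  mulS (coefR _ h.contDiffOn_speed) * D eR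

theorem opX_apply (h : Background M k rp) (u : Sm rp) :
    h.opX u = mulS (coefR _ h.contDiffOn_speed) (D eR u) := rfl

theorem opX_mulS_coefR (h : Background M k rp) {f : ℝ → ℂ}
    (hf : ContDiffOn ℝ (⊤ : ℕ∞) f (Ioi rp)) (u : Sm rp) {p : ℝ × ℝ × ℝ × ℝ} (hp : p ∈ OmSet rp) :
    (h.opX (mulS (coefR f hf) u)).1 p = f p.2.1 * (h.opX u).1 p +
      ((Del M k p.2.1 / p.2.1 ^ 2 : ℝ) : ℂ) * deriv f p.2.1 * u.1 p := by
  have hv : eR.2.1 = 1 := rfl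
  simp [opX_apply, D_mulS, mulS_apply, D_coefR_apply hf eR hp, coefR_apply, hp, hv]
  ring

theorem opX_opV (h : Background M k rp) (u : Sm rp) :
    h.opX (h.opV u) = h.opV (h.opX u) - h.opW u := by
  refine Sm.ext_on fun p hp => ?_
  have hr : p.2.1 ≠ 0 := (h.rp_pos.trans hp.1).ne'
  have hd := (hasDerivAt_inv hr).ofReal_comp
  rw [opV, h.opX_mulS_coefR _ _ hp, hd.deriv]
  simp [opW, mulS_apply, coefR_apply, hp, ww]
  ring

theorem opX_opW (h : Background M k rp) (u : Sm rp) :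
    h.opX (h.opW u) = h.opW (h.opX u) - (2 : ℂ) • h.opW (h.opV u)
      + (6 * (M : ℂ)) • h.opW (h.opV (h.opV u)) := by
  refine Sm.ext_on fun p hp => ?_
  have hr : p.2.1 ≠ 0 := (h.rp_pos.trans hp.1).ne'
  have hr' : (p.2.1 : ℂ) ≠ 0 := by exact_mod_cast hr
  rw [opW, h.opX_mulS_coefR _ _ hp, (hasDerivAt_ww hr).ofReal_comp.deriv]
  simp [opV, mulS_apply, coefR_apply, hp, ww]
  field_simp
  ring

theorem opW_opWi (h : Background M k rp) (u : Sm rp) : h.opW (h.opWi u) = u := by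
  refine Sm.ext_on fun p hp => ?_
  have : ((ww M k p.2.1 : ℝ) : ℂ) ≠ 0 := by exact_mod_cast (h.ww_pos hp.1).ne'
  simp [opW, opWi, mulS_apply, coefR_apply, hp, this]

theorem opV_opW (h : Background M k rp) (u : Sm rp) : h.opV (h.opW u) = h.opW (h.opV u) :=
  mulS_comm _ _ _

theorem opWi_opW (h : Background M k rp) (u : Sm rp) : h.opWi (h.opW u) = u :=
  (mulS_comm _ _ _).trans (h.opW_opWi u)

theorem T_opV (h : Background M k rp) (u : Sm rp) : D eT (h.opV u) = h.opV (D eT u) :=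
  D_mulS_of_eq_zero (D_coefR_eq_zero _ rfl) u

theorem T_opW (h : Background M k rp) (u : Sm rp) : D eT (h.opW u) = h.opW (D eT u) :=
  D_mulS_of_eq_zero (D_coefR_eq_zero _ rfl) u

theorem T_opX (h : Background M k rp) (u : Sm rp) : D eT (h.opX u) = h.opX (D eT u) := by
  rw [opX_apply, opX_apply, D_mulS_of_eq_zero (D_coefR_eq_zero _ rfl), D_comm]

theorem ang_opV (h : Background M k rp) (u : Sm rp) : ang (h.opV u) = h.opV (ang u) :=
  ang_coefR _ u

theorem ang_opW (h : Background M k rp) (u : Sm rp) : ang (h.opW u) = h.opW (ang u) :=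
  ang_coefR _ u

theorem ang_opX (h : Background M k rp) (u : Sm rp) : ang (h.opX u) = h.opX (ang u) := by
  rw [opX_apply, opX_apply, ang_coefR, D_ang rfl]

/-- `L`. -/
def L (h : Background M k rp) : Module.End ℂ (Sm rp) := D eT + h.opX
/-- `L̲`. -/
def Lb (h : Background M k rp) : Module.End ℂ (Sm rp) := D eT - h.opX

end Background

namespace Rep

variable {M k : ℝ} {u : F4} {σ : Sm rp}

theorem opL (hu : Rep u σ) (h : Background M k rp) : Rep (opL M k u) (h.L σ) :=
  hu.dT.add (hu.dR.coefR_mul h.contDiffOn_speed)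

theorem opLb (hu : Rep u σ) (h : Background M k rp) : Rep (opLb M k u) (h.Lb σ) :=
  hu.dT.sub (hu.dR.coefR_mul h.contDiffOn_speed)

theorem wmul (hu : Rep u σ) (h : Background M k rp) : Rep (wmul M k u) (h.opW σ) :=
  hu.coefR_mul _

theorem winv (hu : Rep u σ) (h : Background M k rp) : Rep (winv M k u) (h.opWi σ) :=
  hu.coefR_mul _

end Rep

/-- `u → 0` at infinity. -/
def Z (u : Sm rp) : Prop :=
  ∀ t φ : ℝ, ∀ ϑ ∈ Ioo (0 : ℝ) Real.pi, Tendsto (fun r => u.1 (t, r, ϑ, φ)) atTop (𝓝 0)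

/-- `u` converges at infinity to a limit which is continuous in the angular variables. -/
def Cv (u : Sm rp) : Prop :=
  ∃ q : ℝ → ℝ → ℝ → ℂ,
    (∀ t, ContinuousOn (fun y : ℝ × ℝ => q t y.1 y.2) {y | y.1 ∈ Ioo 0 Real.pi}) ∧
    ∀ t φ : ℝ, ∀ ϑ ∈ Ioo (0 : ℝ) Real.pi,
      Tendsto (fun r => u.1 (t, r, ϑ, φ)) atTop (𝓝 (q t ϑ φ))

theorem Rep.eventuallyEq {q : F4} {σ : Sm rp} (h : Rep q σ) (t φ : ℝ) {ϑ : ℝ}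
    (hϑ : ϑ ∈ Ioo (0 : ℝ) Real.pi) :
    (fun r => q t r ϑ φ) =ᶠ[atTop] fun r => σ.1 (t, r, ϑ, φ) := by
  filter_upwards [eventually_gt_atTop rp] with r hr using h t r ϑ φ ⟨hr, hϑ⟩

theorem Rep.tends0_iff {q : F4} {σ : Sm rp} (h : Rep q σ) : tends0 q ↔ Z σ :=
  forall_congr' fun t => forall_congr' fun φ => forall₂_congr fun _ hϑ =>
    tendsto_congr' (h.eventuallyEq t φ hϑ)

theorem Rep.cv {q : F4} {σ : Sm rp} (h : Rep q σ) (hq : Nice q) : Cv σ := by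
  obtain ⟨q0, hs, hl⟩ := hq
  refine ⟨q0, fun t => ?_, fun t φ ϑ hϑ => (hl t φ ϑ hϑ).1.congr' (h.eventuallyEq t φ hϑ)⟩
  exact hs.continuousOn.comp (f := fun y : ℝ × ℝ => (t, y.1, y.2)) (by fun_prop) fun y hy => hy

namespace Z

variable {u v : Sm rp}

theorem add (hu : Z u) (hv : Z v) : Z (u + v) := fun t φ ϑ hϑ => by
  simpa using (hu t φ ϑ hϑ).add (hv t φ ϑ hϑ)

theorem sub (hu : Z u) (hv : Z v) : Z (u - v) := fun t φ ϑ hϑ => by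
  simpa using (hu t φ ϑ hϑ).sub (hv t φ ϑ hϑ)

theorem smul (a : ℂ) (hu : Z u) : Z (a • u) := fun t φ ϑ hϑ => by
  simpa using (hu t φ ϑ hϑ).const_mul a

theorem neg (hu : Z u) : Z (-u) := fun t φ ϑ hϑ => by
  simpa using (hu t φ ϑ hϑ).neg

theorem mulS_coefR {f : ℝ → ℂ} (hf : ContDiffOn ℝ (⊤ : ℕ∞) f (Ioi rp)) {z : ℂ}
    (hz : Tendsto f atTop (𝓝 z)) (hu : Z u) : Z (mulS (coefR f hf) u) := fun t φ ϑ hϑ => by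
  have h := hz.mul (hu t φ ϑ hϑ)
  rw [mul_zero] at h
  refine h.congr' ?_
  filter_upwards [eventually_gt_atTop rp] with r hr
  have hp : (t, r, ϑ, φ) ∈ OmSet rp := ⟨hr, hϑ⟩
  simp [mulS_apply, coefR_apply hf hp]

theorem mulS_coefTh {f : ℝ → ℂ} (hf : ContDiffOn ℝ (⊤ : ℕ∞) f (Ioo 0 Real.pi)) (hu : Z u) :
    Z (mulS (coefTh f hf) u) := fun t φ ϑ hϑ => by
  have h := (hu t φ ϑ hϑ).const_mul (f ϑ)
  rw [mul_zero] at h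
  refine h.congr' ?_
  filter_upwards [eventually_gt_atTop rp] with r hr
  have hp : (t, r, ϑ, φ) ∈ OmSet rp := ⟨hr, hϑ⟩
  simp [mulS_apply, coefTh_apply hf hp]

theorem cv (hu : Z u) : Cv u := ⟨fun _ _ _ => 0, fun _ => continuousOn_const, hu⟩

end Z

namespace Cv

variable {u v : Sm rp}

theorem add (hu : Cv u) (hv : Cv v) : Cv (u + v) := by
  obtain ⟨q, hq, hqu⟩ := hu
  obtain ⟨q', hq', hqv⟩ := hv
  exact ⟨fun t ϑ φ => q t ϑ φ + q' t ϑ φ, fun t => (hq t).add (hq' t), fun t φ ϑ hϑ => by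
    simpa using (hqu t φ ϑ hϑ).add (hqv t φ ϑ hϑ)⟩

theorem sub (hu : Cv u) (hv : Cv v) : Cv (u - v) := by
  obtain ⟨q, hq, hqu⟩ := hu
  obtain ⟨q', hq', hqv⟩ := hv
  exact ⟨fun t ϑ φ => q t ϑ φ - q' t ϑ φ, fun t => (hq t).sub (hq' t), fun t φ ϑ hϑ => by
    simpa using (hqu t φ ϑ hϑ).sub (hqv t φ ϑ hϑ)⟩

theorem smul (a : ℂ) (hu : Cv u) : Cv (a • u) := by
  obtain ⟨q, hq, hqu⟩ := hu
  exact ⟨fun t ϑ φ => a * q t ϑ φ, fun t => continuousOn_const.mul (hq t), fun t φ ϑ hϑ => by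
    simpa using (hqu t φ ϑ hϑ).const_mul a⟩

theorem mulS_coefR {f : ℝ → ℂ} (hf : ContDiffOn ℝ (⊤ : ℕ∞) f (Ioi rp)) {z : ℂ}
    (hz : Tendsto f atTop (𝓝 z)) (hu : Cv u) : Cv (mulS (coefR f hf) u) := by
  obtain ⟨q, hq, hqu⟩ := hu
  refine ⟨fun t ϑ φ => z * q t ϑ φ, fun t => continuousOn_const.mul (hq t), fun t φ ϑ hϑ => ?_⟩
  refine (hz.mul (hqu t φ ϑ hϑ)).congr' ?_
  filter_upwards [eventually_gt_atTop rp] with r hr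
  have hp : (t, r, ϑ, φ) ∈ OmSet rp := ⟨hr, hϑ⟩
  simp [mulS_apply, coefR_apply hf hp]

theorem mulS_coefR_zero {f : ℝ → ℂ} (hf : ContDiffOn ℝ (⊤ : ℕ∞) f (Ioi rp))
    (hz : Tendsto f atTop (𝓝 0)) (hu : Cv u) : Z (mulS (coefR f hf) u) := by
  obtain ⟨q, -, hqu⟩ := hu
  intro t φ ϑ hϑ
  have h := hz.mul (hqu t φ ϑ hϑ)
  rw [zero_mul] at h
  refine h.congr' ?_
  filter_upwards [eventually_gt_atTop rp] with r hr
  have hp : (t, r, ϑ, φ) ∈ OmSet rp := ⟨hr, hϑ⟩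
  simp [mulS_apply, coefR_apply hf hp]

end Cv

theorem tendsto_ww (M k : ℝ) : Tendsto (fun r => ((ww M k r : ℝ) : ℂ)) atTop (𝓝 ((k ^ 2 : ℝ) : ℂ)) := by
  refine (Complex.continuous_ofReal.tendsto _).comp ?_
  have hi : Tendsto (fun r : ℝ => r⁻¹) atTop (𝓝 0) := tendsto_inv_atTop_zero
  have h : Tendsto (fun r : ℝ => r⁻¹ ^ 2 + k ^ 2 - 2 * M * r⁻¹ ^ 3) atTop (𝓝 (k ^ 2)) := by
    simpa using ((hi.pow 2).add_const (k ^ 2)).sub ((hi.pow 3).const_mul (2 * M))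
  refine h.congr' ?_
  filter_upwards [eventually_gt_atTop 0] with r hr
  unfold ww Del
  field_simp

theorem Z.opW {M k : ℝ} {u : Sm rp} (h : Background M k rp) (hu : Z u) : Z (h.opW u) := hu.mulS_coefR _ (tendsto_ww M k)

theorem Z.opWi {M k : ℝ} {u : Sm rp} (h : Background M k rp) (hu : Z u) : Z (h.opWi u) :=
  hu.mulS_coefR _ ((tendsto_ww M k).inv₀ (by exact_mod_cast (pow_pos h.k_pos 2).ne'))

theorem Cv.opW {M k : ℝ} {u : Sm rp} (h : Background M k rp) (hu : Cv u) : Cv (h.opW u) := hu.mulS_coefR _ (tendsto_ww M k)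

theorem Cv.opV {M k : ℝ} {u : Sm rp} (h : Background M k rp) (hu : Cv u) : Z (h.opV u) :=
  hu.mulS_coefR_zero _ (by
    simpa only [Complex.ofReal_zero, Function.comp_def] using
      (Complex.continuous_ofReal.tendsto _).comp (tendsto_inv_atTop_zero (𝕜 := ℝ)))

theorem Z.ang_of_cv {u : Sm rp} (h0 : Z u) (hTh : Z (D eTh u)) (hPh : Z (D ePh u))
    (hc : Cv (ang u)) : Z (ang u) := by
  obtain ⟨c, hcc, hcl⟩ := hc
  intro t φ ϑ hϑ
  suffices hzero : (Real.sin ϑ : ℂ) * c t ϑ φ = 0 by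
    have hs : (Real.sin ϑ : ℂ) ≠ 0 := by exact_mod_cast sin_ne_zero_of_mem hϑ
    have := hcl t φ ϑ hϑ
    rwa [(mul_eq_zero.1 hzero).resolve_left hs] at this
  set F : Sm rp := -(mulS cSin (D eTh u)) with hF
  set G : Sm rp := -(mulS cSin (mulS cSinSqInv (D ePh u))) - mulS cSin (mulS cPh u) with hG
  set E : Sm rp := mulS cSin (mulS cPot u) with hE
  have hFz : Z F := Z.neg (hTh.mulS_coefTh _)
  have hGz : Z G := (Z.neg ((hPh.mulS_coefTh _).mulS_coefTh _)).sub ((h0.mulS_coefTh _).mulS_coefTh _)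
  have hEz : Z E := (h0.mulS_coefTh _).mulS_coefTh _
  have hsum : mulS cSin (ang u) = D eTh F + D ePh G + E := by
    have hd : ∀ {f} (hf : ContDiffOn ℝ (⊤ : ℕ∞) f (Ioo 0 Real.pi)) (w : Sm rp),
        D ePh (mulS (coefTh f hf) w) = mulS (coefTh f hf) (D ePh w) := fun hf w =>
      D_mulS_of_eq_zero (D_coefTh_eq_zero hf rfl) w
    have hone : ∀ w : Sm rp, mulS cSin (mulS cSinInv w) = w := fun w => Sm.ext_on fun p hp => by
      have hs : Complex.sin (p.2.2.1 : ℂ) ≠ 0 := by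
        exact_mod_cast sin_ne_zero_of_mem hp.2
      simp [mulS_apply, cSin, cSinInv, coefTh_apply, hp, hs]
    simp only [ang_apply, map_add, map_sub, map_neg, hone, hF, hG, hE]
    simp only [cSin, cSinSqInv, cPh, hd]
    abel
  set U : Set (ℝ × ℝ) := {y | y.1 ∈ Ioo 0 Real.pi} with hUdef
  have hU : IsOpen U := isOpen_Ioo.preimage continuous_fst
  have hmem : ∀ {r : ℝ} {y : ℝ × ℝ}, rp < r → y ∈ U → (t, r, y.1, y.2) ∈ OmSet rp :=
    fun hr hy => ⟨hr, hy⟩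
  have hsm : ∀ (σ : Sm rp) (r : ℝ), rp < r →
      ContDiffOn ℝ 1 (fun y : ℝ × ℝ => σ.1 (t, r, y.1, y.2)) U := fun σ r hr =>
    (σ.2.1.of_le (by exact_mod_cast le_top)).comp (f := fun y : ℝ × ℝ => (t, r, y.1, y.2))
      (by fun_prop) fun y hy => hmem hr hy
  have hfd : ∀ (σ : Sm rp) (r : ℝ), rp < r → ∀ y ∈ U, ∀ v : ℝ × ℝ,
      fderiv ℝ (fun y : ℝ × ℝ => σ.1 (t, r, y.1, y.2)) y v =
        (D (0, 0, v.1, v.2) σ).1 (t, r, y.1, y.2) := by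
    intro σ r hr y hy v
    have hγ : HasFDerivAt (fun y : ℝ × ℝ => (t, r, y.1, y.2))
        ((0 : ℝ × ℝ →L[ℝ] ℝ).prod ((0 : ℝ × ℝ →L[ℝ] ℝ).prod (ContinuousLinearMap.id ℝ (ℝ × ℝ)))) y :=
      (hasFDerivAt_const t y).prodMk ((hasFDerivAt_const r y).prodMk (hasFDerivAt_id y))
    have hσ := (Sm.differentiableAt σ (hmem hr hy)).hasFDerivAt
    rw [D_apply _ _ (hmem hr hy)]
    exact congrArg (fun l => l v) (hσ.comp y hγ).fderiv
  refine eq_zero_of_tendsto_divergence hU (R := rp)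
    (f := fun r y => F.1 (t, r, y.1, y.2)) (g := fun r y => G.1 (t, r, y.1, y.2))
    (e := fun r y => E.1 (t, r, y.1, y.2))
    (c := fun y => (Real.sin y.1 : ℂ) * c t y.1 y.2) (hsm F) (hsm G)
    (ContinuousOn.mul (by fun_prop) (hcc t)) (fun y hy => hFz t y.2 y.1 hy)
    (fun y hy => hGz t y.2 y.1 hy) (fun y hy => hEz t y.2 y.1 hy) (fun y hy => ?_) (ϑ, φ) hϑ
  refine ((hcl t y.2 y.1 hy).const_mul (Real.sin y.1 : ℂ)).congr' ?_
  filter_upwards [eventually_gt_atTop rp] with r hr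
  rw [hfd F r hr y hy, hfd G r hr y hy]
  have := congrArg (fun w : Sm rp => w.1 (t, r, y.1, y.2)) hsum
  simpa [mulS_apply, cSin, coefTh_apply, hmem hr hy, eTh, ePh] using this

theorem Z.angular_deriv_of_nice {q q' : F4} {σ τ : Sm rp} (h : Rep q σ) (h' : Rep q' τ)
    (hq : Nice q) (hq' : Nice q') (hz : Z (σ - τ)) :
    Z (D eTh (σ - τ)) ∧ Z (D ePh (σ - τ)) := by
  obtain ⟨a, -, ha⟩ := hq
  obtain ⟨b, -, hb⟩ := hq'
  have hab : ∀ t φ, ∀ ϑ ∈ Ioo (0 : ℝ) Real.pi, a t ϑ φ = b t ϑ φ := by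
    intro t φ ϑ hϑ
    have h1 := (ha t φ ϑ hϑ).1.congr' (h.eventuallyEq t φ hϑ)
    have h2 := (hb t φ ϑ hϑ).1.congr' (h'.eventuallyEq t φ hϑ)
    exact sub_eq_zero.1 (tendsto_nhds_unique (h1.sub h2) (by simpa using hz t φ ϑ hϑ))
  constructor <;> intro t φ ϑ hϑ
  · have h1 := (ha t φ ϑ hϑ).2.2.1.congr' (h.dTh.eventuallyEq t φ hϑ)
    have h2 := (hb t φ ϑ hϑ).2.2.1.congr' (h'.dTh.eventuallyEq t φ hϑ)
    have he : (fun s => a t s φ) =ᶠ[𝓝 ϑ] fun s => b t s φ := by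
      filter_upwards [isOpen_Ioo.mem_nhds hϑ] with s hs using hab t φ s hs
    simpa [he.deriv_eq] using h1.sub h2
  · have h1 := (ha t φ ϑ hϑ).2.2.2.congr' (h.dPh.eventuallyEq t φ hϑ)
    have h2 := (hb t φ ϑ hϑ).2.2.2.congr' (h'.dPh.eventuallyEq t φ hϑ)
    have he : (fun s => a t ϑ s) = fun s => b t ϑ s := funext fun s => hab t s ϑ hϑ
    simpa [he] using h1.sub h2

/-- Commutation relations between `∂ₜ`, the radial derivation, the angular operator and the
multiplications by `w` and `1 / r`. -/
structure Relations {S : Type*} [AddCommGroup S] [Module ℂ S] (m : ℂ)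
    (T X A W V : Module.End ℂ S) : Prop where
  TX : ∀ u, T (X u) = X (T u)
  TA : ∀ u, T (A u) = A (T u)
  TW : ∀ u, T (W u) = W (T u)
  TV : ∀ u, T (V u) = V (T u)
  AX : ∀ u, A (X u) = X (A u)
  AW : ∀ u, A (W u) = W (A u)
  AV : ∀ u, A (V u) = V (A u)
  VW : ∀ u, V (W u) = W (V u)
  XV : ∀ u, X (V u) = V (X u) - W u
  XW : ∀ u, X (W u) = W (X u) - (2 : ℂ) • W (V u) + (6 * m) • W (V (V u))

namespace Relations

variable {S : Type*} [AddCommGroup S] [Module ℂ S] {m : ℂ} {T X A W V : Module.End ℂ S}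

theorem neg (h : Relations m T X A W V) : Relations (-m) T (-X) A W (-V) where
  TX u := by simp [h.TX]
  TA := h.TA
  TW := h.TW
  TV u := by simp [h.TV]
  AX u := by simp [h.AX]
  AW := h.AW
  AV u := by simp [h.AV]
  VW u := by simp [h.VW]
  XV u := by simp [h.XV]
  XW u := by
    simp only [LinearMap.neg_apply, h.XW, map_neg]
    module

/-- First Chandrasekhar transformation: if `w ψ = L P`, then `w L ψ = L L P - (w'/w) L P`. -/
theorem W_transform (h : Relations m T X A W V) {ψ Q : S} (hψ : W ψ = Q) :
    W (T ψ + X ψ) = T Q + X Q + (2 : ℂ) • V Q - (6 * m) • V (V Q) := by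
  subst hψ
  simp only [h.TW, h.XW, h.VW, map_add]
  module

/-- The Regge–Wheeler equation as a transport equation for `ψ = w⁻¹ L P`. -/
theorem W_transport (h : Relations m T X A W V) {P ψ : S}
    (hRW : X (X P) = T (T P) + W (A P) - (6 * m) • W (V P)) (hψ : W ψ = T P + X P) :
    W (T ψ - X ψ) = W ((-2 : ℂ) • V ψ + (6 * m) • V (V ψ) - A P + (6 * m) • V P) := by
  have h1 : T (W ψ) - X (W ψ) = -(W (A P)) + (6 * m) • W (V P) := by
    rw [hψ]
    simp only [map_add, h.TX, hRW]
    module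
  simp only [h.TW, h.XW] at h1
  simp only [map_add, map_sub, map_smul]
  linear_combination (norm := module) h1

theorem difference (h : Relations m T X A W V) {P F a b E : S}
    (hP : X (X P) = T (T P) + W (A P) - (6 * m) • W (V P))
    (hF : X (X F) = T (T F) + W (A F) - (6 * m) • W (V F))
    (ha : a = T (T P + X P) + X (T P + X P) + (2 : ℂ) • V (T P + X P)
      - (6 * m) • V (V (T P + X P)))
    (hb : b = T (T F - X F) - X (T F - X F) - (2 : ℂ) • V (T F - X F)
      + (6 * m) • V (V (T F - X F)))
    (hE : E = (6 * m) • (T (T P + X P) + X (T P + X P) + (T (T F - X F) - X (T F - X F)))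
      + A (A ((T P + X P) - (T F - X F)) - (2 : ℂ) • ((T P + X P) - (T F - X F)))) :
    (A (A a - (2 : ℂ) • a) + (12 * m) • T a) - (A (A b - (2 : ℂ) • b) - (12 * m) • T b) =
      (2 : ℂ) • T E + (W (A (A (A (P - F))) - (2 : ℂ) • A (A (P - F))))
      - (6 * m) • W (V (A (A (P - F)) - (2 : ℂ) • A (P - F)))
      + ((2 : ℂ) • V (A (A ((T P + X P) + (T F - X F)) - (2 : ℂ) • ((T P + X P) + (T F - X F)))
          + (12 * m) • T ((T P + X P) - (T F - X F)))
        - (6 * m) • V (V (A (A ((T P + X P) + (T F - X F)) - (2 : ℂ) • ((T P + X P) + (T F - X F)))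
          + (12 * m) • T ((T P + X P) - (T F - X F))))) := by
  subst ha hb hE
  simp only [map_add, map_sub, map_smul, h.TX, h.TA, h.TW, h.TV, h.AX, h.AW, h.AV, hP, hF,
    smul_add, smul_sub, smul_smul]
  module

theorem radial_transform (h : Relations m T X A W V) {P a : S}
    (hP : X (X P) = T (T P) + W (A P) - (6 * m) • W (V P))
    (ha : a = T (T P + X P) + X (T P + X P) + (2 : ℂ) • V (T P + X P)
      - (6 * m) • V (V (T P + X P))) :
    T a - X a = -W (A (T P + X P) - (2 : ℂ) • (T P + X P) + (6 * m) • V (T P + X P))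
      - (6 * m) • W (W P) := by
  have hTP := congrArg T hP
  simp only [map_add, map_sub, map_smul, h.TX, h.TA, h.TW, h.TV] at hTP
  subst ha
  simp only [map_add, map_sub, map_smul, h.TX, h.TA, h.TW, h.TV, h.AX, h.VW, h.XV, h.XW, hP,
    hTP]
  module

theorem transversal_difference (h : Relations m T X A W V) {P F a b E LP LF : S}
    (ha : T a - X a = -W (A LP - (2 : ℂ) • LP + (6 * m) • V LP) - (6 * m) • W (W P))
    (hb : T b + X b = -W (A LF - (2 : ℂ) • LF + (6 * m) • V LF) + (6 * m) • W (W F))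
    (hLP : T LP - X LP = -(W (A P)) + (6 * m) • W (V P))
    (hLF : T LF + X LF = -(W (A F)) + (6 * m) • W (V F))
    (hE : E = (6 * m) • (T LP + X LP + (T LF - X LF)) + A (A (LP - LF) - (2 : ℂ) • (LP - LF)))
    {α β : S} (hα : α = A (A a - (2 : ℂ) • a) + (12 * m) • T a)
    (hβ : β = A (A b - (2 : ℂ) • b) - (12 * m) • T b) :
    (T α - X α) - (T β + X β) =
      -W (A E - (2 : ℂ) • E)
      - (6 * m) • W (V (A (A (LP - LF) - (2 : ℂ) • (LP - LF))
        + (6 * m) • W (A (P + F) - (2 : ℂ) • (P + F)) + (12 * m) • T (LP + LF)))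
      - (72 * m ^ 2) • W (W (T (P - F))) := by
  have hXP : X LP = T LP + W (A P) - (6 * m) • W (V P) := by linear_combination (norm := module) -hLP
  have hXF : X LF = -T LF - W (A F) + (6 * m) • W (V F) := by linear_combination (norm := module) hLF
  have hα' : T α - X α =
      A (A (T a - X a) - (2 : ℂ) • (T a - X a)) + (12 * m) • T (T a - X a) := by
    simp only [hα, map_add, map_sub, map_smul, h.TX, h.TA, h.AX]
    module
  have hβ' : T β + X β =
      A (A (T b + X b) - (2 : ℂ) • (T b + X b)) - (12 * m) • T (T b + X b) := by
    simp only [hβ, map_add, map_sub, map_smul, h.TX, h.TA, h.AX]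
    module
  rw [hα', hβ', ha, hb, hE, hXP, hXF]
  simp only [map_add, map_sub, map_smul, map_neg, h.TA, h.TW, h.TV, h.AW, h.AV, h.VW]
  module
end Relations

namespace Background

variable {M k : ℝ}

theorem relations (h : Background M k rp) :
    Relations (M : ℂ) (D eT) h.opX ang h.opW h.opV where
  TX := h.T_opX
  TA := D_ang rfl
  TW := h.T_opW
  TV := h.T_opV
  AX := h.ang_opX
  AW := h.ang_opW
  AV := h.ang_opV
  VW := h.opV_opW
  XV := h.opX_opV
  XW := h.opX_opW

theorem L_apply (h : Background M k rp) (u : Sm rp) : h.L u = D eT u + h.opX u := rfl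

theorem Lb_apply (h : Background M k rp) (u : Sm rp) : h.Lb u = D eT u - h.opX u := rfl

theorem opW_injective (h : Background M k rp) : Function.Injective h.opW :=
  Function.LeftInverse.injective h.opWi_opW

/-- The Regge–Wheeler equation. -/
def RW (h : Background M k rp) (u : Sm rp) : Prop :=
  h.opX (h.opX u) = D eT (D eT u) + h.opW (ang u) - (6 * (M : ℂ)) • h.opW (h.opV u)

theorem RW.dT {h : Background M k rp} {u : Sm rp} (hu : h.RW u) : h.RW (D eT u) := by
  have hR := h.relations
  have := congrArg (D eT) hu
  simpa only [RW, map_add, map_sub, map_smul, hR.TX, hR.TA, hR.TW, hR.TV] using this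

theorem RW.neg {h : Background M k rp} {u : Sm rp} (hu : h.RW u) :
    (-h.opX) ((-h.opX) u) = D eT (D eT u) + h.opW (ang u)
      - (6 * -(M : ℂ)) • h.opW ((-h.opV) u) := by
  simp only [LinearMap.neg_apply, map_neg, neg_neg]
  rw [show h.opX (h.opX u) = _ from hu]
  module

theorem ang_eq_of_transport (h : Background M k rp) {P ψ : Sm rp} (hP : h.RW P)
    (hψ : h.opW ψ = h.L P) :
    ang P = (6 * (M : ℂ)) • h.opV (h.opV ψ) - (2 : ℂ) • h.opV ψ + (6 * (M : ℂ)) • h.opV P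
      - h.Lb ψ := by
  have := h.opW_injective (h.relations.W_transport hP hψ)
  rw [Lb_apply]
  linear_combination (norm := module) this

theorem ang_eq_of_transport' (h : Background M k rp) {F φ : Sm rp} (hF : h.RW F)
    (hφ : h.opW φ = h.Lb F) :
    ang F = (2 : ℂ) • h.opV φ - (6 * (M : ℂ)) • h.opV (h.opV φ) + (6 * (M : ℂ)) • h.opV F
      - h.L φ := by
  have := h.opW_injective (h.relations.neg.W_transport hF.neg
    (by rw [hφ, Lb_apply, LinearMap.neg_apply, sub_eq_add_neg]))
  simp only [LinearMap.neg_apply, map_neg] at this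
  rw [L_apply]
  linear_combination (norm := module) this

theorem difference_tendsto (h : Background M k rp) {P F a b E : Sm rp} (hP : h.RW P) (hF : h.RW F)
    (ha : a = h.L (h.L P) + (2 : ℂ) • h.opV (h.L P) - (6 * (M : ℂ)) • h.opV (h.opV (h.L P)))
    (hb : b = h.Lb (h.Lb F) - (2 : ℂ) • h.opV (h.Lb F)
      + (6 * (M : ℂ)) • h.opV (h.opV (h.Lb F)))
    (hE : E = (6 * (M : ℂ)) • (h.L (h.L P) + h.Lb (h.Lb F))
      + ang (ang (h.L P - h.Lb F) - (2 : ℂ) • (h.L P - h.Lb F)))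
    (hET : Z (D eT E)) (h1 : Z (ang (P - F))) (h2 : Z (ang (ang (P - F))))
    (h3 : Z (ang (ang (ang (P - F)))))
    (hLP : Cv (D eT (h.L P)) ∧ Cv (ang (h.L P)) ∧ Cv (ang (ang (h.L P))))
    (hLF : Cv (D eT (h.Lb F)) ∧ Cv (ang (h.Lb F)) ∧ Cv (ang (ang (h.Lb F)))) :
    Z ((ang (ang a - (2 : ℂ) • a) + (12 * (M : ℂ)) • D eT a)
      - (ang (ang b - (2 : ℂ) • b) - (12 * (M : ℂ)) • D eT b)) := by
  simp only [L_apply, Lb_apply] at ha hb hE hLP hLF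
  rw [h.relations.difference hP hF (by simpa only using ha) (by simpa only using hb)
    (by simpa only using hE)]
  obtain ⟨p1, p2, p3⟩ := hLP
  obtain ⟨f1, f2, f3⟩ := hLF
  have hy : Cv (ang (ang ((D eT P + h.opX P) + (D eT F - h.opX F))
        - (2 : ℂ) • ((D eT P + h.opX P) + (D eT F - h.opX F)))
      + (12 * (M : ℂ)) • D eT ((D eT P + h.opX P) - (D eT F - h.opX F))) := by
    have := ((p3.add f3).sub ((p2.add f2).smul 2)).add ((p1.sub f1).smul (12 * (M : ℂ)))
    convert this using 1
    simp only [map_add, map_sub, map_smul]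
  refine (((hET.smul 2).add ((h3.sub (h2.smul 2)).opW h)).sub
    ((Z.opW h (Cv.opV h (h2.sub (h1.smul 2)).cv)).smul _)).add
    (((hy.opV h).smul 2).sub ((Cv.opV h (hy.opV h).cv).smul _))

/-- All `∂ₜʲ 𝓛ⁿ u` with `j ≤ 3`, `n ≤ 2` converge at infinity. -/
def CvAll (u : Sm rp) : Prop := ∀ j n : ℕ, j ≤ 3 → n ≤ 2 → Cv ((D eT)^[j] (ang^[n] u))

/-- All `∂ₜʲ 𝓛ⁿ u` with `j ≤ 3`, `n ≤ 2` tend to zero at infinity. -/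
def ZAll (u : Sm rp) : Prop := ∀ j n : ℕ, j ≤ 3 → n ≤ 2 → Z ((D eT)^[j] (ang^[n] u))

theorem iterate_T_comm {f : Module.End ℂ (Sm rp)} (hf : ∀ u, D eT (f u) = f (D eT u)) (j : ℕ)
    (u : Sm rp) : (D eT)^[j] (f u) = f ((D eT)^[j] u) :=
  Function.Commute.iterate_left hf j u

theorem iterate_T_add (j : ℕ) (u v : Sm rp) :
    (D eT)^[j] (u + v) = (D eT)^[j] u + (D eT)^[j] v := by
  rw [← Module.End.coe_pow, map_add]

theorem iterate_T_sub (j : ℕ) (u v : Sm rp) :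
    (D eT)^[j] (u - v) = (D eT)^[j] u - (D eT)^[j] v := by
  rw [← Module.End.coe_pow, map_sub]

theorem iterate_T_smul (j : ℕ) (a : ℂ) (u : Sm rp) :
    (D eT)^[j] (a • u) = a • (D eT)^[j] u := by
  rw [← Module.End.coe_pow, map_smul]

/-- The third power of `𝓛` converges on solutions of the Regge–Wheeler equation. -/
theorem cv_ang_cube (h : Background M k rp) {P ψ : Sm rp} (hP : h.RW P)
    (hψ : h.opW ψ = h.L P) (cP : CvAll P) (cψ : CvAll ψ) (cLψ : CvAll (h.Lb ψ)) {j : ℕ}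
    (hj : j ≤ 3) : Cv ((D eT)^[j] (ang (ang (ang P)))) := by
  have hR := h.relations
  rw [h.ang_eq_of_transport hP hψ]
  have c0 : Cv ((D eT)^[j] (ang (ang P))) := cP j 2 hj le_rfl
  have c1 : Cv ((D eT)^[j] (ang (ang ψ))) := cψ j 2 hj le_rfl
  have c2 : Cv ((D eT)^[j] (ang (ang (h.Lb ψ)))) := cLψ j 2 hj le_rfl
  simp only [map_add, map_sub, map_smul, hR.AV, iterate_T_add, iterate_T_sub, iterate_T_smul,
    iterate_T_comm h.T_opV]
  exact ((((Cv.opV h (c1.opV h).cv).cv.smul _).sub ((c1.opV h).cv.smul _)).add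
    ((c0.opV h).cv.smul _)).sub c2

theorem cv_ang_cube' (h : Background M k rp) {F φ : Sm rp} (hF : h.RW F)
    (hφ : h.opW φ = h.Lb F) (cF : CvAll F) (cφ : CvAll φ) (cLφ : CvAll (h.L φ)) {j : ℕ}
    (hj : j ≤ 3) : Cv ((D eT)^[j] (ang (ang (ang F)))) := by
  have hR := h.relations
  rw [h.ang_eq_of_transport' hF hφ]
  have c0 : Cv ((D eT)^[j] (ang (ang F))) := cF j 2 hj le_rfl
  have c1 : Cv ((D eT)^[j] (ang (ang φ))) := cφ j 2 hj le_rfl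
  have c2 : Cv ((D eT)^[j] (ang (ang (h.L φ)))) := cLφ j 2 hj le_rfl
  simp only [map_add, map_sub, map_smul, hR.AV, iterate_T_add, iterate_T_sub, iterate_T_smul,
    iterate_T_comm h.T_opV]
  exact ((((c1.opV h).cv.smul _).sub ((Cv.opV h (c1.opV h).cv).cv.smul _)).add
    ((c0.opV h).cv.smul _)).sub c2

/-- The reverse Chandrasekhar transformation maps the Regge–Wheeler boundary conditions to the
conformal Teukolsky boundary conditions. -/
theorem teukolsky_boundary (h : Background M k rp) {P F ψ φ a b α β E : Sm rp}
    (hP : h.RW P) (hF : h.RW F) (hψ : h.opW ψ = h.L P) (hφ : h.opW φ = h.Lb F)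
    (ha : a = h.opW (h.L ψ)) (hb : b = h.opW (h.Lb φ))
    (hα : α = ang (ang a - (2 : ℂ) • a) + (12 * (M : ℂ)) • D eT a)
    (hβ : β = ang (ang b - (2 : ℂ) • b) - (12 * (M : ℂ)) • D eT b)
    (hE : E = (6 * (M : ℂ)) • (h.L (h.L P) + h.Lb (h.Lb F))
      + ang (ang (h.L P - h.Lb F) - (2 : ℂ) • (h.L P - h.Lb F)))
    (cP : CvAll P) (cF : CvAll F) (cLP : CvAll (h.L P)) (cLF : CvAll (h.Lb F))
    (cψ : CvAll ψ) (cφ : CvAll φ) (cLψ : CvAll (h.Lb ψ)) (cLφ : CvAll (h.L φ))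
    (zδ : ZAll (P - F)) (zE : ZAll E)
    (zang : ∀ j ≤ 3, Z (D eTh ((D eT)^[j] (ang (ang (P - F))))) ∧
      Z (D ePh ((D eT)^[j] (ang (ang (P - F)))))) :
    Z (α - β) ∧ Z (h.Lb α - h.L β) ∧ Z (h.opWi (h.opX α + h.opX β)) := by
  have hR := h.relations
  have ha' : a = h.L (h.L P) + (2 : ℂ) • h.opV (h.L P)
      - (6 * (M : ℂ)) • h.opV (h.opV (h.L P)) := ha.trans (hR.W_transform hψ)
  have hb' : b = h.Lb (h.Lb F) - (2 : ℂ) • h.opV (h.Lb F)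
      + (6 * (M : ℂ)) • h.opV (h.opV (h.Lb F)) := by
    have := hR.neg.W_transform hφ
    simp only [LinearMap.neg_apply, map_neg, neg_neg, ← sub_eq_add_neg] at this
    rw [hb, Lb_apply, this, Lb_apply _ (h.Lb F)]
    module
  have z3 : ∀ j ≤ 3, Z ((D eT)^[j] (ang (ang (ang (P - F))))) := fun j hj => by
    rw [iterate_T_comm hR.TA]
    refine Z.ang_of_cv (zδ j 2 hj le_rfl) (zang j hj).1 (zang j hj).2 ?_
    rw [← iterate_T_comm hR.TA]
    simp only [map_sub, iterate_T_sub]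
    exact (h.cv_ang_cube hP hψ cP cψ cLψ hj).sub (h.cv_ang_cube' hF hφ cF cφ cLφ hj)
  have g1 : Z (α - β) := by
    rw [hα, hβ]
    exact h.difference_tendsto hP hF ha' hb' hE (zE 1 0 (by simp) (by simp))
      (zδ 0 1 (by simp) (by simp)) (zδ 0 2 (by simp) (by simp)) (z3 0 (by simp))
      ⟨cLP 1 0 (by simp) (by simp), cLP 0 1 (by simp) (by simp), cLP 0 2 (by simp) (by simp)⟩
      ⟨cLF 1 0 (by simp) (by simp), cLF 0 1 (by simp) (by simp), cLF 0 2 (by simp) (by simp)⟩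
  have TL : ∀ u, D eT (h.L u) = h.L (D eT u) := fun u => by simp [L_apply, hR.TX]
  have TLb : ∀ u, D eT (h.Lb u) = h.Lb (D eT u) := fun u => by simp [Lb_apply, hR.TX]
  have gT : Z (D eT (α - β)) := by
    have key := h.difference_tendsto hP.dT hF.dT (a := D eT a) (b := D eT b) (E := D eT E)
      (by simp only [ha', map_add, map_sub, map_smul, hR.TV, TL])
      (by simp only [hb', map_add, map_sub, map_smul, hR.TV, TLb])
      (by simp only [hE, map_add, map_sub, map_smul, hR.TA, TL, TLb])
      (zE 2 0 (by simp) (by simp))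
      (by simpa only [map_sub, hR.TA] using
        (show Z (D eT (ang (P - F))) from zδ 1 1 (by simp) (by simp)))
      (by simpa only [map_sub, hR.TA] using
        (show Z (D eT (ang (ang (P - F)))) from zδ 1 2 (by simp) (by simp)))
      (by simpa only [map_sub, hR.TA] using
        (show Z (D eT (ang (ang (ang (P - F))))) from z3 1 (by simp)))
      (by
        simp only [← TL, ← hR.TA]
        exact ⟨cLP 2 0 (by simp) (by simp), cLP 1 1 (by simp) (by simp),
          cLP 1 2 (by simp) (by simp)⟩)
      (by
        simp only [← TLb, ← hR.TA]
        exact ⟨cLF 2 0 (by simp) (by simp), cLF 1 1 (by simp) (by simp),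
          cLF 1 2 (by simp) (by simp)⟩)
    rw [hα, hβ]
    simpa only [map_add, map_sub, map_smul, hR.TA] using key
  have g2 : Z (h.Lb α - h.L β) := by
    have hLP : D eT (h.L P) - h.opX (h.L P) =
        -(h.opW (ang P)) + (6 * (M : ℂ)) • h.opW (h.opV P) := by
      simp only [L_apply, map_add, hR.TX]
      rw [show h.opX (h.opX P) = _ from hP]
      module
    have hLF : D eT (h.Lb F) + h.opX (h.Lb F) =
        -(h.opW (ang F)) + (6 * (M : ℂ)) • h.opW (h.opV F) := by
      simp only [Lb_apply, map_sub, hR.TX]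
      rw [show h.opX (h.opX F) = _ from hF]
      module
    have hab := hR.radial_transform hP ha'
    have hbb := hR.neg.radial_transform hF.neg (a := b) (by
      simp only [hb', Lb_apply, LinearMap.neg_apply, map_neg, map_sub, map_add]
      module)
    simp only [LinearMap.neg_apply, ← sub_eq_add_neg, ← Lb_apply, sub_neg_eq_add, mul_neg, neg_smul,
      smul_neg, neg_neg] at hbb
    rw [Lb_apply, L_apply, hR.transversal_difference (P := P) (F := F) (LP := h.L P)
      (LF := h.Lb F) hab hbb hLP hLF hE hα hβ]
    have d : ∀ {u : Sm rp}, CvAll u → Cv u ∧ Cv (ang u) ∧ Cv (ang (ang u)) ∧ Cv (D eT u) :=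
      fun hu => ⟨hu 0 0 (by simp) (by simp), hu 0 1 (by simp) (by simp),
        hu 0 2 (by simp) (by simp), hu 1 0 (by simp) (by simp)⟩
    obtain ⟨-, p1, p2, p3⟩ := d cLP
    obtain ⟨-, f1, f2, f3⟩ := d cLF
    obtain ⟨P0, P1, -⟩ := d cP
    obtain ⟨F0, F1, -⟩ := d cF
    have hy : Cv (ang (ang (h.L P - h.Lb F) - (2 : ℂ) • (h.L P - h.Lb F))
        + (6 * (M : ℂ)) • h.opW (ang (P + F) - (2 : ℂ) • (P + F))
        + (12 * (M : ℂ)) • D eT (h.L P + h.Lb F)) := by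
      have := (((p2.sub f2).sub ((p1.sub f1).smul 2)).add
        ((Cv.opW h ((P1.add F1).sub ((P0.add F0).smul 2))).smul (6 * (M : ℂ)))).add
        ((p3.add f3).smul (12 * (M : ℂ)))
      convert this using 1
      simp only [map_add, map_sub, map_smul]
    have e0 : Z E := zE 0 0 (by simp) (by simp)
    have e1 : Z (ang E) := zE 0 1 (by simp) (by simp)
    have d1 : Z (D eT (P - F)) := zδ 1 0 (by simp) (by simp)
    exact ((Z.opW h (e1.sub (e0.smul 2))).neg.sub ((Z.opW h (hy.opV h)).smul _)).sub ((Z.opW h (d1.opW h)).smul _)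
  refine ⟨g1, g2, Z.opWi h ?_⟩
  have : h.opX α + h.opX β = D eT (α - β) - (h.Lb α - h.L β) := by
    rw [Lb_apply, L_apply, map_sub]
    abel
  rw [this]
  exact gT.sub g2

end Background

theorem deriv_conj (f : ℝ → ℂ) (x : ℝ) :
    deriv (fun s => (starRingEnd ℂ) (f s)) x = (starRingEnd ℂ) (deriv f x) := by
  simpa only [starRingEnd_apply] using deriv.star (f := f) (x := x)

theorem conjF_dT (u : F4) : conjF (dT u) = dT (conjF u) := by
  funext t r ϑ φ
  exact (deriv_conj _ _).symm

theorem conjF_dR (u : F4) : conjF (dR u) = dR (conjF u) := by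
  funext t r ϑ φ
  exact (deriv_conj _ _).symm

theorem conjF_dTh (u : F4) : conjF (dTh u) = dTh (conjF u) := by
  funext t r ϑ φ
  exact (deriv_conj _ _).symm

theorem conjF_dPh (u : F4) : conjF (dPh u) = dPh (conjF u) := by
  funext t r ϑ φ
  exact (deriv_conj _ _).symm

theorem conjF_opL (M k : ℝ) (u : F4) : conjF (opL M k u) = opL M k (conjF u) := by
  funext t r ϑ φ
  simp only [opL, ← conjF_dT, ← conjF_dR]
  simp only [conjF, opL, map_add, map_mul, Complex.conj_ofReal]

theorem conjF_opLb (M k : ℝ) (u : F4) : conjF (opLb M k u) = opLb M k (conjF u) := by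
  funext t r ϑ φ
  simp only [opLb, ← conjF_dT, ← conjF_dR]
  simp only [conjF, opLb, map_sub, map_mul, Complex.conj_ofReal]

theorem conjF_winv (M k : ℝ) (u : F4) : conjF (winv M k u) = winv M k (conjF u) := by
  funext t r ϑ φ
  simp only [winv, conjF, map_mul, map_inv₀, Complex.conj_ofReal]

theorem conjF_wmul (M k : ℝ) (u : F4) : conjF (wmul M k u) = wmul M k (conjF u) := by
  funext t r ϑ φ
  simp only [wmul, conjF, map_mul, Complex.conj_ofReal]

theorem conjF_angM (u : F4) : conjF (angM u) = angP (conjF u) := by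
  funext t r ϑ φ
  have h1 : deriv (fun x => (Real.sin x : ℂ) * dTh (conjF u) t r x φ) ϑ =
      (starRingEnd ℂ) (deriv (fun x => (Real.sin x : ℂ) * dTh u t r x φ) ϑ) := by
    rw [← deriv_conj, ← conjF_dTh]
    simp only [conjF, map_mul, Complex.conj_ofReal]
  simp only [angP, h1, ← conjF_dPh]
  simp only [conjF, angM, map_add, map_sub, map_mul, map_neg, map_inv₀, Complex.conj_ofReal,
    Complex.conj_I, map_ofNat]
  ring

theorem conjF_angSqM (u : F4) : conjF (angSqM u) = angSqP (conjF u) := by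
  rw [angSqM, conjF_angM, angSqP]
  refine congrArg angP ?_
  rw [← conjF_angM]
  funext t r ϑ φ
  simp only [conjF, map_sub, map_mul, map_ofNat]

theorem conjF_TSm (M : ℝ) (u : F4) : conjF (TSm M u) =
    fun t r ϑ φ => angSqP (conjF u) t r ϑ φ - 12 * (M : ℂ) * dT (conjF u) t r ϑ φ := by
  funext t r ϑ φ
  rw [← conjF_angSqM, ← conjF_dT]
  simp only [conjF, TSm, map_sub, map_mul, map_ofNat, Complex.conj_ofReal]

theorem conjF_RWm (M k : ℝ) (u : F4) : conjF (RWm M k u) = RWp M k (conjF u) := by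
  funext t r ϑ φ
  simp only [RWp, ← conjF_angM, ← conjF_opL, ← conjF_opLb]
  simp only [conjF, RWm, map_sub, map_neg, map_mul, Complex.conj_ofReal]

theorem SmoothOnOm.conjF {u : F4} (hu : SmoothOnOm rp u) : SmoothOnOm rp (conjF u) :=
  Complex.conjCLE.contDiff.comp_contDiffOn hu

theorem Background.rw_of_rep {M k : ℝ} (h : Background M k rp) {u : F4} {σ : Sm rp} (hu : Rep u σ)
    (hRW : ∀ t r ϑ φ : ℝ, (t, r, ϑ, φ) ∈ OmSet rp → RWp M k u t r ϑ φ = 0) : h.RW σ := by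
  have hR := h.relations
  have key : h.L (h.Lb σ) = (6 * (M : ℂ)) • h.opW (h.opV σ) - h.opW (ang σ) := by
    refine Sm.ext_on fun p hp => ?_
    have e := hRW p.1 p.2.1 p.2.2.1 p.2.2.2 hp
    rw [RWp, ((hu.opLb h).opL h) _ _ _ _ hp, hu.angP _ _ _ _ hp, hu _ _ _ _ hp] at e
    simp [opW, opV, mulS_apply, coefR_apply, hp] at e ⊢
    linear_combination -e
  simp only [L_apply, Lb_apply, map_sub, hR.TX] at key
  rw [RW]
  linear_combination (norm := module) -key

theorem Rep.cvAll {u : F4} {σ : Sm rp} (hu : Rep u σ)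
    (h : ∀ j n : ℕ, j ≤ 3 → n ≤ 2 → Nice (Grav.dT^[j] (Grav.angP^[n] u))) : Background.CvAll σ :=
  fun j n hj hn => ((hu.angP_iterate n).dT_iterate j).cv (h j n hj hn)

theorem Rep.zAll {u : F4} {σ : Sm rp} (hu : Rep u σ)
    (h : ∀ j n : ℕ, j ≤ 3 → n ≤ 2 → tends0 (Grav.dT^[j] (Grav.angP^[n] u))) : Background.ZAll σ :=
  fun j n hj hn => ((hu.angP_iterate n).dT_iterate j).tends0_iff.1 (h j n hj hn)

theorem Background.ZAll.smul {u : Sm rp} (hu : Background.ZAll u) (a : ℂ) :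
    Background.ZAll (a • u) := fun j n hj hn => by
  rw [← Module.End.coe_pow ang, map_smul, Module.End.coe_pow, Background.iterate_T_smul]
  exact (hu j n hj hn).smul a

theorem Rep.sq_dR {M k : ℝ} {u : F4} {σ : Sm rp} (hu : Rep u σ) (h : Background M k rp) :
    Rep (fun t r ϑ φ => ((r ^ 2 : ℝ) : ℂ) * Grav.dR u t r ϑ φ) (h.opWi (h.opX σ)) := by
  intro t r ϑ φ hp
  have hr : (r : ℂ) ≠ 0 := by exact_mod_cast (h.rp_pos.trans hp.1).ne'
  have hw : ((ww M k r : ℝ) : ℂ) ≠ 0 := by exact_mod_cast (h.ww_pos hp.1).ne'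
  have hs : ((Del M k r / r ^ 2 : ℝ) : ℂ) = ((ww M k r : ℝ) : ℂ) * (r : ℂ) ^ 2 := by
    rw [ww]
    push_cast
    field_simp
  simp only [hu.dR t r ϑ φ hp, Background.opWi, Background.opX_apply, mulS_apply,
    coefR_apply _ hp, hs]
  field_simp
  push_cast
  ring

end

/-- The reverse Chandrasekhar transformations of solutions of the
Regge–Wheeler problem satisfy the conformal Teukolsky boundary conditions. -/
theorem statement7
    (M k rp : ℝ) (hM : 0 < M) (hk : 0 < k) (hrp : 0 < rp)
    (hroot : rp + k ^ 2 * rp ^ 3 - 2 * M = 0)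
    (Ψp Ψm : F4) (hΨp : SmoothOnOm rp Ψp) (hΨm : SmoothOnOm rp Ψm)
    (hRWp : ∀ t r ϑ φ : ℝ, (t, r, ϑ, φ) ∈ OmSet rp → RWp M k Ψp t r ϑ φ = 0)
    (hRWm : ∀ t r ϑ φ : ℝ, (t, r, ϑ, φ) ∈ OmSet rp → RWm M k Ψm t r ϑ φ = 0)
    (ψpr ψmr intp intm αpr αmr : F4)
    (hψpr : ψpr = winv M k (opL M k Ψp))
    (hψmr : ψmr = winv M k (opLb M k Ψm))
    (hintp : intp = wmul M k (opL M k ψpr))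
    (hintm : intm = wmul M k (opLb M k ψmr))
    (hαpr : αpr = TSp M intp)
    (hαmr : αmr = TSm M intm)
    -- (H1): regularity-at-infinity hypotheses
    (hH1 : ∀ j n : ℕ, j ≤ 3 → n ≤ 2 →
      ∀ q ∈ ({Ψp, conjF Ψm, ψpr, conjF ψmr, intp, conjF intm} : Set F4),
        Nice (dT^[j] (angP^[n] q)) ∧ Nice (dT^[j] (angP^[n] (opL M k q))) ∧
          Nice (dT^[j] (angP^[n] (opLb M k q))))
    -- (H2): Regge–Wheeler boundary conditions together with their derivatives
    (hH2 : ∀ j n : ℕ, j ≤ 3 → n ≤ 2 →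
      tends0 (dT^[j] (angP^[n] (fun t r ϑ φ => Ψp t r ϑ φ - conjF Ψm t r ϑ φ))) ∧
      tends0 (dT^[j] (angP^[n] (fun t r ϑ φ =>
        opL M k (opL M k Ψp) t r ϑ φ + opLb M k (opLb M k (conjF Ψm)) t r ϑ φ
          + ((6 * M : ℝ) : ℂ)⁻¹ *
              angSqP (fun t r ϑ φ =>
                opL M k Ψp t r ϑ φ - opLb M k (conjF Ψm) t r ϑ φ) t r ϑ φ)))) :
    tends0 (fun t r ϑ φ => αpr t r ϑ φ - conjF αmr t r ϑ φ) ∧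
    tends0 (fun t r ϑ φ => opLb M k αpr t r ϑ φ - opL M k (conjF αmr) t r ϑ φ) ∧
    tends0 (fun t r ϑ φ =>
      ((r ^ 2 : ℝ) : ℂ) * dR αpr t r ϑ φ + ((r ^ 2 : ℝ) : ℂ) * dR (conjF αmr) t r ϑ φ) := by
  have h : Background M k rp := ⟨hM, hk, hrp, hroot⟩
  have hφ : conjF ψmr = winv M k (opLb M k (conjF Ψm)) := by
    rw [hψmr, conjF_winv, conjF_opLb]
  have hb : conjF intm = wmul M k (opLb M k (conjF ψmr)) := by
    rw [hintm, conjF_wmul, conjF_opLb]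
  have rP := rep_of_smooth hΨp
  have rF := rep_of_smooth hΨm.conjF
  set P := cut _ hΨp
  set F := cut _ hΨm.conjF
  have rψ := (rP.opL h).winv h
  have rφ := (rF.opLb h).winv h
  rw [← hψpr] at rψ
  rw [← hφ] at rφ
  have ra := (rψ.opL h).wmul h
  have rb := (rφ.opLb h).wmul h
  rw [← hintp] at ra
  rw [← hb] at rb
  have rα := ra.angSqP.add (ra.dT.const_mul (12 * (M : ℂ)))
  have rβ := rb.angSqP.sub (rb.dT.const_mul (12 * (M : ℂ)))
  rw [← conjF_TSm, ← hαmr] at rβ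
  change Rep (TSp M intp) _ at rα
  rw [← hαpr] at rα
  have hRWm' : ∀ t r ϑ φ : ℝ, (t, r, ϑ, φ) ∈ OmSet rp → RWp M k (conjF Ψm) t r ϑ φ = 0 := by
    intro t r ϑ φ hp
    rw [← conjF_RWm, conjF, hRWm t r ϑ φ hp, map_zero]
  have rE := (((rP.opL h).opL h).add ((rF.opLb h).opLb h)).add
    (((rP.opL h).sub (rF.opLb h)).angSqP.const_mul ((6 * M : ℝ) : ℂ)⁻¹)
  have zE := rE.zAll fun j n hj hn => (hH2 j n hj hn).2
  have zδ := (rP.sub rF).zAll fun j n hj hn => (hH2 j n hj hn).1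
  have hM' : (6 * (M : ℂ)) ≠ 0 := by simpa using hM.ne'
  have main := h.teukolsky_boundary (h.rw_of_rep rP hRWp) (h.rw_of_rep rF hRWm')
    (h.opW_opWi _) (h.opW_opWi _) rfl rfl rfl rfl rfl
    (rP.cvAll fun j n hj hn => (hH1 j n hj hn _ (by simp)).1)
    (rF.cvAll fun j n hj hn => (hH1 j n hj hn _ (by simp)).1)
    ((rP.opL h).cvAll fun j n hj hn => (hH1 j n hj hn _ (by simp)).2.1)
    ((rF.opLb h).cvAll fun j n hj hn => (hH1 j n hj hn _ (by simp)).2.2)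
    (rψ.cvAll fun j n hj hn => (hH1 j n hj hn _ (by simp)).1)
    (rφ.cvAll fun j n hj hn => (hH1 j n hj hn _ (by simp)).1)
    ((rψ.opLb h).cvAll fun j n hj hn => (hH1 j n hj hn _ (by simp)).2.2)
    ((rφ.opL h).cvAll fun j n hj hn => (hH1 j n hj hn _ (by simp)).2.1)
    zδ
    (by
      have := zE.smul (6 * (M : ℂ))
      rwa [smul_add, smul_smul, Complex.ofReal_mul, Complex.ofReal_ofNat, mul_inv_cancel₀ hM',
        one_smul] at this)
    (fun j hj => by
      have hsub : (D eT)^[j] (ang (ang (P - F))) =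
          (D eT)^[j] (ang (ang P)) - (D eT)^[j] (ang (ang F)) := by
        rw [map_sub, map_sub, Background.iterate_T_sub]
      have hz : Z ((D eT)^[j] (ang (ang (P - F)))) := zδ j 2 hj le_rfl
      rw [hsub] at hz ⊢
      exact Z.angular_deriv_of_nice ((rP.angP_iterate 2).dT_iterate j)
        ((rF.angP_iterate 2).dT_iterate j) (hH1 j 2 hj le_rfl _ (by simp)).1
        (hH1 j 2 hj le_rfl _ (by simp)).1 hz)
  refine ⟨(rα.sub rβ).tends0_iff.2 main.1,
    ((rα.opLb h).sub (rβ.opL h)).tends0_iff.2 main.2.1, Rep.tends0_iff ?_ |>.2 main.2.2⟩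
  rw [map_add]
  exact (rα.sq_dR h).add (rβ.sq_dR h)

end Grav
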